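/- arXiv:1901.07133 — 2 statements merged into one kernel-verified Lean document; each statement's English description precedes it below -/
import Mathlib

section
/- Let m be a positive integer with m ≥ 2 and let G be a finite group. If G is cyclic of order at least 6, then G admits an m-GRR. If G is dicyclic (i.e. generalized dicyclic over a cyclic group) and G is not isomorphic to Q8, then G admits an m-GRR. -/
/-- A permutation `σ` of the vertex set is an automorphism of the simple graph `Γ`. -/
def IsGraphAut {V : Type*} (Γ : SimpleGraph V) (σ : Equiv.Perm V) : Prop :=
  ∀ u v : V, Γ.Adj (σ u) (σ v) ↔ Γ.Adj u v

/-- `G` admits an `m`-graphical regular representation: a regular finite simple graph whose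
full automorphism group is (the image of) `G`, acting semiregularly with exactly `m` orbits. -/
def HasMGRR (G : Type*) [Group G] (m : ℕ) : Prop :=
  ∃ (V : Type) (_ : Fintype V) (Γ : SimpleGraph V) (ρ : G →* Equiv.Perm V),
    (∃ d : ℕ, ∀ v : V, (Γ.neighborSet v).ncard = d) ∧
    (∀ g : G, IsGraphAut Γ (ρ g)) ∧
    (∀ σ : Equiv.Perm V, IsGraphAut Γ σ → ∃ g : G, ρ g = σ) ∧
    Function.Injective ⇑ρ ∧
    (∀ (g : G) (v : V), ρ g v = v → g = 1) ∧
    (∃ reps : Fin m → V, ∀ v : V, ∃! i : Fin m, ∃ g : G, ρ g (reps i) = v)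

/-- `G` is dicyclic (generalized dicyclic over a cyclic group): it has a cyclic subgroup `A`
of exponent greater than `2`, and an element `x` with `x²` an involution of `A`,
`x⁻¹ a x = a⁻¹` for all `a ∈ A`, and `G = ⟨A, x⟩`. -/
def IsDicyclic (G : Type*) [Group G] : Prop :=
  ∃ (A : Subgroup G) (x : G),
    IsCyclic ↥A ∧
    (∃ a ∈ A, a * a ≠ 1) ∧
    x ^ 2 ∈ A ∧ x ^ 2 ≠ 1 ∧ x ^ 4 = 1 ∧
    (∀ a ∈ A, x⁻¹ * a * x = a⁻¹) ∧
    Subgroup.closure ((A : Set G) ∪ {x}) = ⊤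

/-- Left multiplication by `g` on the first coordinate of `G × Fin m`. -/
def leftTranslation (G : Type*) [Group G] (m : ℕ) : G →* Equiv.Perm (G × Fin m) where
  toFun g := (Equiv.mulLeft g).prodCongr (Equiv.refl _)
  map_one' := by ext u <;> simp
  map_mul' g h := by ext u <;> simp [mul_assoc]

theorem leftTranslation_apply {G : Type*} [Group G] {m : ℕ} (g : G) (u : G × Fin m) :
    leftTranslation G m g u = (g * u.1, u.2) := rfl

theorem hasMGRR_of_graph {G : Type} [Group G] [Finite G] {m : ℕ} (hm : 0 < m)
    (Γ : SimpleGraph (G × Fin m))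
    (hinv : ∀ (g : G) (u v : G × Fin m),
      Γ.Adj (g * u.1, u.2) (g * v.1, v.2) ↔ Γ.Adj u v)
    (d : ℕ) (hd : ∀ i, (Γ.neighborSet (1, i)).ncard = d)
    (haut : ∀ σ : Equiv.Perm (G × Fin m), IsGraphAut Γ σ →
      ∃ g : G, ∀ u, σ u = (g * u.1, u.2)) :
    HasMGRR G m := by
  refine ⟨G × Fin m, Fintype.ofFinite _, Γ, leftTranslation G m, ⟨d, ?_⟩, ?_, ?_, ?_, ?_, ?_⟩
  · rintro ⟨x, i⟩
    rw [← hd i]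
    conv_rhs => rw [← Set.ncard_image_of_injective _ (leftTranslation G m x).injective]
    congr 1
    ext v
    constructor
    · intro h
      refine ⟨(x⁻¹ * v.1, v.2), ?_, by simp [leftTranslation_apply]⟩
      have := hinv x (1, i) (x⁻¹ * v.1, v.2)
      simp only [mul_one, mul_inv_cancel_left] at this
      exact this.1 h
    · rintro ⟨w, hw, rfl⟩
      have := (hinv x (1, i) w).2 hw
      simpa [leftTranslation_apply] using this
  · intro g u v
    exact hinv g u v
  · intro σ hσ
    obtain ⟨g, hg⟩ := haut σ hσ
    exact ⟨g, Equiv.ext fun u => (hg u).symm⟩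
  · intro g h hgh
    have := congrArg (fun e : Equiv.Perm (G × Fin m) => (e (1, ⟨0, hm⟩)).1) hgh
    simpa [leftTranslation_apply] using this
  · intro g v h
    have := congrArg Prod.fst h
    simpa [leftTranslation_apply] using this
  · refine ⟨fun i => (1, i), fun v => ⟨v.2, ⟨v.1, by simp [leftTranslation_apply]⟩, ?_⟩⟩
    rintro i ⟨g, rfl⟩
    rfl

theorem HasMGRR.of_mulEquiv {G : Type*} {H : Type*} [Group G] [Group H] {m : ℕ} (e : G ≃* H)
    (h : HasMGRR H m) : HasMGRR G m := by
  obtain ⟨V, hV, Γ, ρ, h1, h2, h3, h4, h5, reps, h6⟩ := h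
  refine ⟨V, hV, Γ, ρ.comp e.toMonoidHom, h1, fun g => h2 (e g), fun σ hσ => ?_,
    h4.comp e.injective, fun g v hg => ?_, reps, fun v => ?_⟩
  · obtain ⟨g, hg⟩ := h3 σ hσ
    exact ⟨e.symm g, by simpa using hg⟩
  · simpa using h5 (e g) v hg
  · obtain ⟨i, ⟨g, hg⟩, hi⟩ := h6 v
    exact ⟨i, ⟨e.symm g, by simpa using hg⟩, fun j ⟨g', hg'⟩ => hi j ⟨e g', hg'⟩⟩

theorem map_mul_of_closure_eq_top {G : Type*} [Group G] {s : Set G}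
    (hs : Subgroup.closure s = ⊤) {f : G → G}
    (hf : ∀ g ∈ s, ∀ x, f (x * g) = f x * g) (x : G) : f x = f 1 * x := by
  have key : ∀ g ∈ Subgroup.closure s, ∀ x, f (x * g) = f x * g := by
    intro g hg
    induction hg using Subgroup.closure_induction with
    | mem g hg => exact hf g hg
    | one => simp
    | mul a b _ _ ha hb => intro x; rw [← mul_assoc, hb, ha, mul_assoc]
    | inv a _ ha =>
      intro x
      have := ha (x * a⁻¹)
      rw [inv_mul_cancel_right] at this
      rw [this, mul_inv_cancel_right]
  simpa using key x (hs ▸ Subgroup.mem_top x) 1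

theorem ncard_four {α : Type*} {a b c d : α} (hab : a ≠ b) (hac : a ≠ c) (had : a ≠ d)
    (hbc : b ≠ c) (hbd : b ≠ d) (hcd : c ≠ d) : ({a, b, c, d} : Set α).ncard = 4 := by
  classical
  rw [show ({a, b, c, d} : Set α) = (({a, b, c, d} : Finset α) : Set α) by simp,
    Set.ncard_coe_finset]
  simp [*]

section SquaredPath

variable {G : Type*} [Group G] {m : ℕ}

/-- Two vertices of the same fibre, at distance one or two along the fibre. -/
def FibreRel (u v : G × Fin m) : Prop :=
  u.1 = v.1 ∧ u.2.1 ≠ v.2.1 ∧ u.2.1 ≤ v.2.1 + 2 ∧ v.2.1 ≤ u.2.1 + 2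

/-- The edges between fibres: `a` from layer `0` to layer `1`, `b` from layer `0` to layer `m - 2`
and `a` inside layer `m - 1`. -/
def LinkRel (a b : G) (u v : G × Fin m) : Prop :=
  (u.2.1 = 0 ∧ v.2.1 = 1 ∧ v.1 = u.1 * a) ∨
  (u.2.1 = 0 ∧ v.2.1 + 2 = m ∧ v.1 = u.1 * b) ∨
  (u.2.1 = 1 ∧ v.2.1 = 0 ∧ v.1 = u.1 * a⁻¹) ∨
  (u.2.1 + 2 = m ∧ v.2.1 = 0 ∧ v.1 = u.1 * b⁻¹) ∨
  (u.2.1 + 1 = m ∧ v.2.1 + 1 = m ∧ v.1 = u.1 * a) ∨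
  (u.2.1 + 1 = m ∧ v.2.1 + 1 = m ∧ v.1 = u.1 * a⁻¹)

/-- The squared path on every fibre together with the linking edges. -/
def squaredPathGraph (a b : G) (m : ℕ) : SimpleGraph (G × Fin m) :=
  SimpleGraph.fromRel fun u v => FibreRel u v ∨ LinkRel a b u v

omit [Group G] in
theorem FibreRel.symm {u v : G × Fin m} (h : FibreRel u v) : FibreRel v u :=
  ⟨h.1.symm, h.2.1.symm, h.2.2.2, h.2.2.1⟩

theorem LinkRel.symm {a b : G} {u v : G × Fin m} (h : LinkRel a b u v) : LinkRel a b v u := by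
  obtain ⟨x, i⟩ := u
  obtain ⟨y, j⟩ := v
  unfold LinkRel at *
  dsimp only at *
  rcases h with ⟨h1, h2, rfl⟩ | ⟨h1, h2, rfl⟩ | ⟨h1, h2, rfl⟩ | ⟨h1, h2, rfl⟩ | ⟨h1, h2, rfl⟩ |
    ⟨h1, h2, rfl⟩ <;> simp [h1, h2]

theorem LinkRel.fst_ne {a b : G} (ha : a ≠ 1) (hb : b ≠ 1) {u v : G × Fin m}
    (h : LinkRel a b u v) : u.1 ≠ v.1 := by
  rcases h with ⟨-, -, h⟩ | ⟨-, -, h⟩ | ⟨-, -, h⟩ | ⟨-, -, h⟩ | ⟨-, -, h⟩ | ⟨-, -, h⟩ <;>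
    rw [h] <;> simp [ha, hb]

theorem squaredPathGraph_adj {a b : G} (ha : a ≠ 1) (hb : b ≠ 1) {u v : G × Fin m} :
    (squaredPathGraph a b m).Adj u v ↔ FibreRel u v ∨ LinkRel a b u v := by
  rw [squaredPathGraph, SimpleGraph.fromRel_adj]
  constructor
  · rintro ⟨-, h | h | h⟩
    exacts [h, .inl h.symm, .inr h.symm]
  · refine fun h => ⟨?_, .inl h⟩
    rintro rfl
    rcases h with h | h
    exacts [h.2.1 rfl, h.fst_ne ha hb rfl]

/-- The conditions on the generators `a` and `b` under which the squared path graph is a graphical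
representation. -/
structure IsLinkPair (a b : G) : Prop where
  closure_eq_top : Subgroup.closure {a, b} = ⊤
  sq_ne : a * a ≠ 1
  cube_ne : a * a * a ≠ 1
  right_ne_one : b ≠ 1
  ne : a ≠ b
  ne_inv : b ≠ a⁻¹

namespace IsLinkPair

variable {a b : G} (h : IsLinkPair a b)
include h

theorem left_ne_one : a ≠ 1 := fun ha => h.sq_ne (by simp [ha])

theorem left_ne_inv : a ≠ a⁻¹ := fun ha => h.sq_ne (mul_eq_one_iff_eq_inv.2 ha)

theorem link_unique (hm : 4 ≤ m) {u v w : G × Fin m} (huv : LinkRel a b u v)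
    (huw : LinkRel a b u w) (hvw : v.1 = w.1) : v = w := by
  obtain ⟨x, i⟩ := u
  obtain ⟨y, j⟩ := v
  obtain ⟨z, k⟩ := w
  obtain rfl : y = z := hvw
  have h1 := h.ne
  have h2 := h.ne.symm
  have h3 := h.left_ne_inv
  have h4 := h.left_ne_inv.symm
  unfold LinkRel at huv huw
  dsimp only at huv huw
  rw [Prod.mk.injEq, Fin.ext_iff]
  refine ⟨rfl, ?_⟩
  rcases huv with ⟨hi, hj, rfl⟩ | ⟨hi, hj, rfl⟩ | ⟨hi, hj, rfl⟩ | ⟨hi, hj, rfl⟩ | ⟨hi, hj, rfl⟩ |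
    ⟨hi, hj, rfl⟩ <;> simp only [mul_right_inj] at huw <;> clear h <;> grind

theorem not_link_triangle (hm : 4 ≤ m) {u v w : G × Fin m} (huv : LinkRel a b u v)
    (huw : LinkRel a b u w) (hvw : LinkRel a b v w) : False := by
  obtain ⟨x, i⟩ := u
  obtain ⟨y, j⟩ := v
  obtain ⟨z, k⟩ := w
  have h3 := h.left_ne_one
  have h4 := h.cube_ne
  have h4' : a * (a * a) ≠ 1 := by rwa [← mul_assoc]
  have h5 := h.sq_ne
  have h6 : a * a ≠ a⁻¹ := fun e => h4 (mul_eq_one_iff_eq_inv.2 e)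
  have h7 : a⁻¹ * a⁻¹ ≠ a := fun e => h4' (by nth_rw 1 [← e]; group)
  unfold LinkRel at huv huw hvw
  dsimp only at huv huw hvw
  rcases huv with ⟨hi, hj, rfl⟩ | ⟨hi, hj, rfl⟩ | ⟨hi, hj, rfl⟩ | ⟨hi, hj, rfl⟩ | ⟨hi, hj, rfl⟩ |
    ⟨hi, hj, rfl⟩ <;>
  rcases huw with ⟨hi', hk, rfl⟩ | ⟨hi', hk, rfl⟩ | ⟨hi', hk, rfl⟩ | ⟨hi', hk, rfl⟩ |
    ⟨hi', hk, rfl⟩ | ⟨hi', hk, rfl⟩ <;> try omega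
  all_goals
    simp only [mul_assoc, mul_right_inj] at hvw
    clear h
    have := i.2
    have := j.2
    have := k.2
    rcases hvw with ⟨hj', hk', e⟩ | ⟨hj', hk', e⟩ | ⟨hj', hk', e⟩ | ⟨hj', hk', e⟩ | ⟨hj', hk', e⟩ |
      ⟨hj', hk', e⟩ <;> first | omega | simp [h3, h6.symm, h7.symm] at e

end IsLinkPair

theorem IsLinkPair.ncard_neighborSet {a b : G} (h : IsLinkPair a b) (hm : 4 ≤ m) (i : Fin m) :
    ((squaredPathGraph a b m).neighborSet (1, i)).ncard = 4 := by
  have h1 := h.left_ne_one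
  have h2 := h.right_ne_one
  have h3 := h.ne
  have h4 := h.left_ne_inv
  have h5 : ∀ v, v ∈ (squaredPathGraph a b m).neighborSet (1, i) ↔
      FibreRel (1, i) v ∨ LinkRel a b (1, i) v := fun v =>
    squaredPathGraph_adj h1 h2
  obtain ⟨i, hi⟩ := i
  have cases_i : i = 0 ∨ i = 1 ∨ (2 ≤ i ∧ i + 3 ≤ m) ∨ (2 ≤ i ∧ i + 2 = m) ∨ (2 ≤ i ∧ i + 1 = m) := by
    omega
  rcases cases_i with rfl | rfl | hi' | hi' | hi'
  · rw [show (squaredPathGraph a b m).neighborSet (1, ⟨0, hi⟩) =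
      {(1, ⟨1, by omega⟩), (1, ⟨2, by omega⟩), (a, ⟨1, by omega⟩), (b, ⟨m - 2, by omega⟩)} by
        ext ⟨y, j, hj⟩
        rw [h5]
        simp [FibreRel, LinkRel]
        clear h h5
        grind (splits := 20)]
    apply ncard_four <;> simp [*, eq_comm]
  · rw [show (squaredPathGraph a b m).neighborSet (1, ⟨1, hi⟩) =
      {(1, ⟨0, by omega⟩), (1, ⟨2, by omega⟩), (1, ⟨3, by omega⟩), (a⁻¹, ⟨0, by omega⟩)} by
        ext ⟨y, j, hj⟩
        rw [h5]
        simp [FibreRel, LinkRel]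
        clear h h5
        grind (splits := 20)]
    apply ncard_four <;> simp [*, eq_comm]
  · rw [show (squaredPathGraph a b m).neighborSet (1, ⟨i, hi⟩) =
      {(1, ⟨i - 2, by omega⟩), (1, ⟨i - 1, by omega⟩), (1, ⟨i + 1, by omega⟩),
        (1, ⟨i + 2, by omega⟩)} by
        ext ⟨y, j, hj⟩
        rw [h5]
        simp [FibreRel, LinkRel]
        clear h h5
        grind (splits := 20)]
    apply ncard_four <;> simp <;> omega
  · rw [show (squaredPathGraph a b m).neighborSet (1, ⟨i, hi⟩) =
      {(1, ⟨i - 2, by omega⟩), (1, ⟨i - 1, by omega⟩), (1, ⟨i + 1, by omega⟩),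
        (b⁻¹, ⟨0, by omega⟩)} by
        ext ⟨y, j, hj⟩
        rw [h5]
        simp [FibreRel, LinkRel]
        clear h h5
        grind (splits := 20)]
    apply ncard_four <;> simp [h2] <;> omega
  · rw [show (squaredPathGraph a b m).neighborSet (1, ⟨i, hi⟩) =
      {(1, ⟨i - 2, by omega⟩), (1, ⟨i - 1, by omega⟩), (a, ⟨i, by omega⟩),
        (a⁻¹, ⟨i, by omega⟩)} by
        ext ⟨y, j, hj⟩
        rw [h5]
        simp [FibreRel, LinkRel]
        clear h h5
        grind (splits := 20)]
    apply ncard_four <;> (simp [*, eq_comm]; try omega)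

/-- Two adjacent vertices with a common neighbour. -/
def InTriangle {V : Type*} (Γ : SimpleGraph V) (u v : V) : Prop :=
  Γ.Adj u v ∧ ∃ w, Γ.Adj u w ∧ Γ.Adj v w

theorem IsGraphAut.inTriangle_iff {V : Type*} {Γ : SimpleGraph V} {σ : Equiv.Perm V}
    (h : IsGraphAut Γ σ) {u v : V} : InTriangle Γ (σ u) (σ v) ↔ InTriangle Γ u v := by
  refine and_congr (h u v) (σ.surjective.exists.trans (exists_congr fun w => ?_))
  rw [h u, h v]

namespace IsLinkPair

variable {a b : G} (h : IsLinkPair a b)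
include h

theorem inTriangle_iff (hm : 4 ≤ m) {u v : G × Fin m} :
    InTriangle (squaredPathGraph a b m) u v ↔ FibreRel u v := by
  have hadj : ∀ {u v : G × Fin m}, (squaredPathGraph a b m).Adj u v ↔
      FibreRel u v ∨ LinkRel a b u v := squaredPathGraph_adj h.left_ne_one h.right_ne_one
  have hne : ∀ {u v : G × Fin m}, LinkRel a b u v → u.1 ≠ v.1 :=
    fun {u v} => LinkRel.fst_ne h.left_ne_one h.right_ne_one
  constructor
  · rintro ⟨huv, w, huw, hvw⟩
    rw [hadj] at huv huw hvw
    rcases huv with huv | huv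
    · exact huv
    exfalso
    rcases huw with huw | huw
    · rcases hvw with hvw | hvw
      · exact hne huv (huw.1.trans hvw.1.symm)
      · have := h.link_unique hm huv.symm hvw huw.1
        exact huw.2.1 (by rw [this])
    · rcases hvw with hvw | hvw
      · have := h.link_unique hm huv huw hvw.1
        exact hvw.2.1 (by rw [this])
      · exact h.not_link_triangle hm huv huw hvw
  · intro huv
    refine ⟨hadj.2 (.inl huv), ?_⟩
    obtain ⟨x, i, hi⟩ := u
    obtain ⟨y, j, hj⟩ := v
    obtain ⟨rfl, hij⟩ := huv
    dsimp only at hij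
    have : ∃ k, k < m ∧ i ≠ k ∧ i ≤ k + 2 ∧ k ≤ i + 2 ∧ j ≠ k ∧ j ≤ k + 2 ∧ k ≤ j + 2 := by
      rcases Nat.lt_or_ge (max i j + 1) m with hlt | hge
      · by_cases hd : j = i + 2
        · exact ⟨i + 1, by omega⟩
        by_cases hd' : i = j + 2
        · exact ⟨j + 1, by omega⟩
        exact ⟨max i j + 1, by omega⟩
      · by_cases hd : j = i + 2
        · exact ⟨i + 1, by omega⟩
        by_cases hd' : i = j + 2
        · exact ⟨j + 1, by omega⟩
        exact ⟨min i j - 1, by omega⟩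
    obtain ⟨k, hk, hk'⟩ := this
    exact ⟨(x, ⟨k, hk⟩), hadj.2 (.inl ⟨rfl, hk'.1, hk'.2.1, hk'.2.2.1⟩),
      hadj.2 (.inl ⟨rfl, hk'.2.2.2⟩)⟩

theorem link_iff (hm : 4 ≤ m) {u v : G × Fin m} : LinkRel a b u v ↔
    (squaredPathGraph a b m).Adj u v ∧ ¬ InTriangle (squaredPathGraph a b m) u v := by
  rw [h.inTriangle_iff hm, squaredPathGraph_adj h.left_ne_one h.right_ne_one]
  exact ⟨fun huv => ⟨.inr huv, fun h' => huv.fst_ne h.left_ne_one h.right_ne_one h'.1⟩,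
    fun huv => huv.1.resolve_left huv.2⟩

end IsLinkPair

variable {a b : G} (h : IsLinkPair a b)
include h

namespace IsLinkPair

theorem fst_eq_iff (hm : 4 ≤ m) {u v : G × Fin m} :
    u.1 = v.1 ↔ Relation.ReflTransGen (InTriangle (squaredPathGraph a b m)) u v := by
  constructor
  · obtain ⟨x, i, hi⟩ := u
    obtain ⟨y, j, hj⟩ := v
    rintro rfl
    have up : ∀ k (hk : k < m), Relation.ReflTransGen (InTriangle (squaredPathGraph a b m))
        (x, ⟨0, by omega⟩) (x, ⟨k, hk⟩) := by
      intro k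
      induction k with
      | zero => intro _; exact .refl
      | succ k ih =>
        intro hk
        refine (ih (by omega)).tail ((h.inTriangle_iff hm).2 ⟨rfl, ?_⟩)
        dsimp only
        omega
    have symm : ∀ {u v : G × Fin m},
        Relation.ReflTransGen (InTriangle (squaredPathGraph a b m)) u v →
        Relation.ReflTransGen (InTriangle (squaredPathGraph a b m)) v u := by
      intro u v huv
      have : Std.Symm (InTriangle (squaredPathGraph a b m)) :=
        ⟨fun u v huv => (h.inTriangle_iff hm).2 ((h.inTriangle_iff hm).1 huv).symm⟩
      exact Relation.ReflTransGen.stdSymm.symm _ _ huv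
    exact (symm (up i hi)).trans (up j hj)
  · intro huv
    induction huv with
    | refl => rfl
    | tail _ hvw ih => exact ih.trans ((h.inTriangle_iff hm).1 hvw).1

variable {σ : Equiv.Perm (G × Fin m)} (hσ : IsGraphAut (squaredPathGraph a b m) σ)
include hσ

theorem fst_apply_eq (hm : 4 ≤ m) {u v : G × Fin m} (huv : u.1 = v.1) :
    (σ u).1 = (σ v).1 := by
  rw [h.fst_eq_iff hm] at huv ⊢
  exact huv.lift σ fun u v => hσ.inTriangle_iff.2

theorem link_apply_iff (hm : 4 ≤ m) {u v : G × Fin m} :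
    LinkRel a b (σ u) (σ v) ↔ LinkRel a b u v := by
  rw [h.link_iff hm, h.link_iff hm, hσ u v, hσ.inTriangle_iff]

end IsLinkPair

/-- A vertex incident with two linking edges. -/
def IsFibreEnd (a b : G) (u : G × Fin m) : Prop :=
  ∃ v w, v ≠ w ∧ LinkRel a b u v ∧ LinkRel a b u w

namespace IsLinkPair

theorem isFibreEnd_iff (hm : 4 ≤ m) {u : G × Fin m} :
    IsFibreEnd a b u ↔ u.2.1 = 0 ∨ u.2.1 + 1 = m := by
  have h1 := h.ne
  have h4 := h.left_ne_inv
  obtain ⟨x, i, hi⟩ := u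
  constructor
  · rintro ⟨⟨y, j, hj⟩, ⟨z, k, hk⟩, hne, hv, hw⟩
    unfold LinkRel at hv hw
    dsimp only at *
    simp only [ne_eq, Prod.mk.injEq, Fin.mk.injEq] at hne
    by_contra hcon
    rcases hv with ⟨hi, hj, rfl⟩ | ⟨hi, hj, rfl⟩ | ⟨hi, hj, rfl⟩ | ⟨hi, hj, rfl⟩ | ⟨hi, hj, rfl⟩ |
      ⟨hi, hj, rfl⟩ <;>
    rcases hw with ⟨hi, hk, rfl⟩ | ⟨hi, hk, rfl⟩ | ⟨hi, hk, rfl⟩ | ⟨hi, hk, rfl⟩ |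
      ⟨hi, hk, rfl⟩ | ⟨hi, hk, rfl⟩ <;> first | omega | (exact hne ⟨rfl, by omega⟩)
  · dsimp only
    rintro (rfl | hi')
    · exact ⟨(x * a, ⟨1, by omega⟩), (x * b, ⟨m - 2, by omega⟩), by simp [h1],
        .inl ⟨rfl, rfl, rfl⟩, .inr (.inl ⟨rfl, by dsimp only; omega, rfl⟩)⟩
    · exact ⟨(x * a, ⟨i, hi⟩), (x * a⁻¹, ⟨i, hi⟩), by simp [h4],
        by simp [LinkRel, hi'], by simp [LinkRel, hi']⟩

variable {σ : Equiv.Perm (G × Fin m)} (hσ : IsGraphAut (squaredPathGraph a b m) σ)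
include hσ

theorem isFibreEnd_apply_iff (hm : 4 ≤ m) {u : G × Fin m} :
    IsFibreEnd a b (σ u) ↔ IsFibreEnd a b u := by
  refine σ.surjective.exists.trans (exists_congr fun v =>
    σ.surjective.exists.trans (exists_congr fun w => ?_))
  rw [h.link_apply_iff hσ hm, h.link_apply_iff hσ hm, σ.injective.ne_iff]

omit hσ in
theorem isLast_iff (hm : 4 ≤ m) {u : G × Fin m} :
    u.2.1 + 1 = m ↔ IsFibreEnd a b u ∧ ∃ v, LinkRel a b u v ∧ IsFibreEnd a b v := by
  simp_rw [h.isFibreEnd_iff hm]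
  obtain ⟨x, i, hi⟩ := u
  dsimp only
  constructor
  · intro hi'
    exact ⟨.inr hi', (x * a, ⟨i, hi⟩), by simp [LinkRel, hi'], .inr hi'⟩
  · rintro ⟨hi', ⟨y, j, hj⟩, hl, hj'⟩
    unfold LinkRel at hl
    dsimp only at *
    omega

theorem isLast_apply_iff (hm : 4 ≤ m) {u : G × Fin m} :
    (σ u).2.1 + 1 = m ↔ u.2.1 + 1 = m := by
  rw [h.isLast_iff hm, h.isLast_iff hm, h.isFibreEnd_apply_iff hσ hm]
  refine and_congr_right' (σ.surjective.exists.trans (exists_congr fun v => ?_))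
  rw [h.link_apply_iff hσ hm, h.isFibreEnd_apply_iff hσ hm]

theorem isFirst_apply (hm : 4 ≤ m) {u : G × Fin m} (hu : u.2.1 = 0) : (σ u).2.1 = 0 := by
  have h1 := (h.isFibreEnd_apply_iff hσ hm (u := u)).2 ((h.isFibreEnd_iff hm).2 (.inl hu))
  refine ((h.isFibreEnd_iff hm).1 h1).resolve_right fun h2 => ?_
  have := (h.isLast_apply_iff hσ hm).1 h2
  omega

theorem exists_leftTranslation (hm : 4 ≤ m) : ∃ g : G, ∀ u, σ u = (g * u.1, u.2) := by
  have hlink := fun u v => h.link_apply_iff hσ hm (u := u) (v := v)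
  set f : G → G := fun x => (σ (x, ⟨0, by omega⟩)).1 with hf
  have hfst : ∀ u, (σ u).1 = f u.1 := fun u => h.fst_apply_eq hσ hm rfl
  have hzero : ∀ x, σ (x, ⟨0, by omega⟩) = (f x, ⟨0, by omega⟩) := fun x =>
    Prod.ext rfl (Fin.ext (h.isFirst_apply hσ hm rfl))
  have hlast : ∀ x, σ (x, ⟨m - 1, by omega⟩) = (f x, ⟨m - 1, by omega⟩) := fun x =>
    Prod.ext (hfst _) (Fin.ext (by
      have := (h.isLast_apply_iff hσ hm (u := (x, ⟨m - 1, by omega⟩))).2 (by dsimp only; omega)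
      dsimp only
      omega))
  have hinj : Function.Injective f := fun x y hxy => by
    have : σ (x, ⟨0, by omega⟩) = σ (y, ⟨0, by omega⟩) := by rw [hzero, hzero, hxy]
    simpa using this
  have hab : ∀ {x : G} {v : G × Fin m}, LinkRel a b (x, ⟨0, by omega⟩) v →
      (v.1 = x * a ∧ v.2.1 = 1) ∨ (v.1 = x * b ∧ v.2.1 + 2 = m) := by
    intro x v hl
    unfold LinkRel at hl
    dsimp only at hl
    rcases hl with hl | hl | hl | hl | hl | hl
    exacts [.inl ⟨hl.2.2, hl.2.1⟩, .inr ⟨hl.2.2, hl.2.1⟩, by omega, by omega, by omega, by omega]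
  have ha1 : ∀ x, (f (x * a) = f x * a ∧ (σ (x * a, ⟨1, by omega⟩)).2.1 = 1) := by
    intro x
    have h1 := (hlink (x, ⟨0, by omega⟩) (x * a, ⟨1, by omega⟩)).2 (.inl ⟨rfl, rfl, rfl⟩)
    have h2 := (hlink (x, ⟨m - 1, by omega⟩) (x * a, ⟨m - 1, by omega⟩)).2 (by
      refine .inr (.inr (.inr (.inr (.inl ⟨?_, ?_, rfl⟩)))) <;> dsimp only <;> omega)
    rw [hzero] at h1
    have h3 := hab h1
    rw [hfst] at h3
    refine h3.resolve_right fun h4 => ?_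
    rw [hlast, hlast] at h2
    unfold LinkRel at h2
    dsimp only at h2 h4
    rw [h4.1, mul_right_inj, mul_right_inj] at h2
    rcases h2 with h2 | h2 | h2 | h2 | h2 | h2 <;> first | omega | skip
    exacts [h.ne h2.2.2.symm, h.ne_inv (mul_left_cancel h2.2.2)]
  have hb1 : ∀ x, f (x * b) = f x * b := by
    intro x
    have h1 := (hlink (x, ⟨0, by omega⟩) (x * b, ⟨m - 2, by omega⟩)).2
      (.inr (.inl ⟨rfl, by dsimp only; omega, rfl⟩))
    rw [hzero] at h1
    rcases hab h1 with h2 | h2 <;> rw [hfst] at h2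
    · exact absurd (hinj (h2.1.trans (ha1 x).1.symm)) (by simp [h.ne.symm])
    · exact h2.1
  have hmul := map_mul_of_closure_eq_top h.closure_eq_top (f := f) (by
    rintro g (rfl | rfl) x
    exacts [(ha1 x).1, hb1 x])
  refine ⟨f 1, ?_⟩
  have key : ∀ k (hk : k < m) x, (σ (x, ⟨k, hk⟩)).2.1 = k := by
    intro k
    induction k using Nat.strong_induction_on with
    | _ k ih =>
      intro hk x
      match k, hk, ih with
      | 0, hk, _ => rw [hzero]
      | 1, hk, _ => simpa using (ha1 (x * a⁻¹)).2
      | k + 2, hk, ih =>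
        have h1 := hσ.inTriangle_iff.2 ((h.inTriangle_iff hm
          (u := (x, ⟨k, by omega⟩)) (v := (x, ⟨k + 2, hk⟩))).2
          ⟨rfl, by dsimp only; omega, by dsimp only; omega, by dsimp only; omega⟩)
        have h2 := ((h.inTriangle_iff hm).1 h1).2
        rw [ih k (by omega)] at h2
        by_contra hcon
        set j := (σ (x, ⟨k + 2, hk⟩)).2 with hj
        have h3 := ih j.1 (by omega) j.2 x
        have h4 : σ (x, j) = σ (x, ⟨k + 2, hk⟩) :=
          Prod.ext (by rw [hfst, hfst]) (Fin.ext (h3.trans rfl))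
        have h5 := congrArg (fun u => u.2.1) (σ.injective h4)
        dsimp only at h5
        omega
  rintro ⟨x, k, hk⟩
  exact Prod.ext ((hfst _).trans (hmul x)) (Fin.ext (key k hk x))

end IsLinkPair

end SquaredPath

theorem IsLinkPair.hasMGRR {G : Type} [Group G] [Finite G] {a b : G} (h : IsLinkPair a b) {m : ℕ}
    (hm : 4 ≤ m) : HasMGRR G m := by
  refine hasMGRR_of_graph (by omega) (squaredPathGraph a b m) (fun g u v => ?_) 4
    (h.ncard_neighborSet hm) fun σ hσ => h.exists_leftTranslation hσ hm
  simp [squaredPathGraph_adj h.left_ne_one h.right_ne_one, FibreRel, LinkRel, mul_assoc]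

/-- Two adjacent vertices with at least two common neighbours. -/
def InTwoTriangles {V : Type*} (Γ : SimpleGraph V) (u v : V) : Prop :=
  Γ.Adj u v ∧ ∃ w₁ w₂, w₁ ≠ w₂ ∧ (Γ.Adj u w₁ ∧ Γ.Adj v w₁) ∧ Γ.Adj u w₂ ∧ Γ.Adj v w₂

/-- Two adjacent vertices with at least three common neighbours. -/
def InThreeTriangles {V : Type*} (Γ : SimpleGraph V) (u v : V) : Prop :=
  Γ.Adj u v ∧ ∃ w₁ w₂ w₃, (w₁ ≠ w₂ ∧ w₁ ≠ w₃ ∧ w₂ ≠ w₃) ∧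
    (Γ.Adj u w₁ ∧ Γ.Adj v w₁) ∧ (Γ.Adj u w₂ ∧ Γ.Adj v w₂) ∧ Γ.Adj u w₃ ∧ Γ.Adj v w₃

theorem InTwoTriangles.symm {V : Type*} {Γ : SimpleGraph V} {u v : V}
    (h : InTwoTriangles Γ u v) : InTwoTriangles Γ v u := by
  obtain ⟨h, w₁, w₂, hne, h1, h2⟩ := h
  exact ⟨h.symm, w₁, w₂, hne, h1.symm, h2.symm⟩

theorem IsGraphAut.inTwoTriangles_iff {V : Type*} {Γ : SimpleGraph V} {σ : Equiv.Perm V}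
    (h : IsGraphAut Γ σ) {u v : V} :
    InTwoTriangles Γ (σ u) (σ v) ↔ InTwoTriangles Γ u v := by
  refine and_congr (h u v) (σ.surjective.exists.trans (exists_congr fun w₁ =>
    σ.surjective.exists.trans (exists_congr fun w₂ => ?_)))
  rw [h, h, h, h, σ.injective.ne_iff]

theorem IsGraphAut.inThreeTriangles_iff {V : Type*} {Γ : SimpleGraph V} {σ : Equiv.Perm V}
    (h : IsGraphAut Γ σ) {u v : V} :
    InThreeTriangles Γ (σ u) (σ v) ↔ InThreeTriangles Γ u v := by
  refine and_congr (h u v) (σ.surjective.exists.trans (exists_congr fun w₁ =>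
    σ.surjective.exists.trans (exists_congr fun w₂ =>
    σ.surjective.exists.trans (exists_congr fun w₃ => ?_))))
  rw [h, h, h, h, h, h, σ.injective.ne_iff, σ.injective.ne_iff, σ.injective.ne_iff]

theorem mul_mul_eq_one_rotate {G : Type*} [Group G] {a b c : G} (h : a * b * c = 1) :
    b * c * a = 1 := by
  rwa [mul_assoc, mul_eq_one_comm] at h

section DoubledArc

variable {G : Type*} [Group G] {m : ℕ}

/-- The arcs of the doubled line digraph: both vertices `(x, 0)` and `(x, 1)` point to `(x * p, 0)`
and `(x * q, 1)`. -/
def ArcRel (p q : G) (u v : G × Fin m) : Prop :=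
  u.2.1 ≤ 1 ∧ ((v.2.1 = 0 ∧ v.1 = u.1 * p) ∨ (v.2.1 = 1 ∧ v.1 = u.1 * q))

/-- The arcs inside the layer `2`. -/
def CayleyRel (p q : G) (u v : G × Fin m) : Prop :=
  u.2.1 = 2 ∧ v.2.1 = 2 ∧ (v.1 = u.1 * p ∨ v.1 = u.1 * q)

/-- The underlying graph of the line digraph of the Cayley digraph of `p` and `q`, with each fibre
made complete, together with a Cayley graph on the layer `2` (if there is one). -/
def lineDigraphGraph (p q : G) (m : ℕ) : SimpleGraph (G × Fin m) :=
  SimpleGraph.fromRel fun u v => u.1 = v.1 ∨ ArcRel p q u v ∨ CayleyRel p q u v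

/-- The vertices `u` and `v` are, up to order, `(x, 0)` and `(x, 1)` for some `x`. -/
def MateRel (u v : G × Fin m) : Prop := u.1 = v.1 ∧ u.2.1 + v.2.1 = 1

theorem lineDigraphGraph_adj {p q : G} {u v : G × Fin m} :
    (lineDigraphGraph p q m).Adj u v ↔ u ≠ v ∧ (u.1 = v.1 ∨ ArcRel p q u v ∨ ArcRel p q v u ∨
      CayleyRel p q u v ∨ CayleyRel p q v u) := by
  rw [lineDigraphGraph, SimpleGraph.fromRel_adj]
  grind

/-- The conditions on the generators `p` and `q` under which the line digraph graph is a graphical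
representation. -/
structure IsLinePair (p q : G) : Prop where
  closure_eq_top : Subgroup.closure {p, q} = ⊤
  ne : p ≠ q
  left_sq : p * p ≠ 1
  right_sq : q * q ≠ 1
  mul_ne : p * q ≠ 1
  ppq : p * p * q ≠ 1
  pqq : p * q * q ≠ 1
  qqq : q * q * q ≠ 1
  map_mul_left : ∀ f : G → G, (∀ x, (f (x * p) = f x * p ∧ f (x * q) = f x * q) ∨
    (f (x * p) = f x * q ∧ f (x * q) = f x * p)) → ∀ x, f (x * p) = f x * p

namespace IsLinePair

variable {p q : G} (h : IsLinePair p q)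
include h

theorem left_ne_one : p ≠ 1 := fun hp => h.left_sq (by simp [hp])

theorem right_ne_one : q ≠ 1 := fun hq => h.right_sq (by simp [hq])

theorem mul_ne' : q * p ≠ 1 := fun e => h.mul_ne (mul_eq_one_comm.1 e)

theorem pqp : p * q * p ≠ 1 := fun e =>
  h.ppq (mul_mul_eq_one_rotate (mul_mul_eq_one_rotate e))

theorem qpq : q * p * q ≠ 1 := fun e => h.pqq (mul_mul_eq_one_rotate e)

theorem qpp : q * p * p ≠ 1 := fun e => h.ppq (mul_mul_eq_one_rotate e)

theorem qqp : q * q * p ≠ 1 := fun e =>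
  h.pqq (mul_mul_eq_one_rotate (mul_mul_eq_one_rotate e))

theorem common_neighbour_of_arc {u v w : G × Fin m} (huv : ArcRel p q u v)
    (huw : (lineDigraphGraph p q m).Adj u w) (hvw : (lineDigraphGraph p q m).Adj v w) :
    MateRel u w ∨ (ArcRel p q v w ∧ ArcRel p q w u) := by
  rw [lineDigraphGraph_adj] at huw hvw
  obtain ⟨x, i, hi⟩ := u
  obtain ⟨y, j, hj⟩ := v
  obtain ⟨z, k, hk⟩ := w
  have h1 := h.left_ne_one
  have h2 := h.right_ne_one
  have h3 := h.left_sq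
  have h4 := h.right_sq
  have h5 := h.mul_ne
  have h6 := h.mul_ne'
  have h7 := h.ne
  have h8 := h.ne.symm
  clear h
  simp only [ArcRel, CayleyRel, MateRel, ne_eq, Prod.mk.injEq, Fin.mk.injEq] at *
  obtain ⟨hne1, huw⟩ := huw
  obtain ⟨hne2, hvw⟩ := hvw
  obtain ⟨hi', ⟨rfl, rfl⟩ | ⟨rfl, rfl⟩⟩ := huv <;>
  rcases huw with rfl | ⟨huw, ⟨huw', rfl⟩ | ⟨huw', rfl⟩⟩ | ⟨huw, ⟨huw', rfl⟩ | ⟨huw', rfl⟩⟩ |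
    ⟨huw, huw', -⟩ | ⟨huw, huw', -⟩ <;> try omega
  all_goals
    rcases hvw with hvw | ⟨hvw, ⟨hvw', hvw2⟩ | ⟨hvw', hvw2⟩⟩ | ⟨hvw, ⟨hvw', hvw2⟩ | ⟨hvw', hvw2⟩⟩ |
      ⟨hvw, hvw', -⟩ | ⟨hvw, hvw', -⟩ <;> try omega
  all_goals first
    | (simp [*, mul_assoc] at hvw2; done)
    | (simp [*, mul_assoc] at hvw; done)
    | exact absurd ⟨rfl, huw'.symm⟩ hne2
    | exact .inl ⟨rfl, by simp at hne1; omega⟩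
    | grind

theorem common_neighbour_of_cayley {u v w : G × Fin m} (huv : CayleyRel p q u v)
    (huw : (lineDigraphGraph p q m).Adj u w) (hvw : (lineDigraphGraph p q m).Adj v w) :
    w.2.1 = 2 ∧ ((v.1 = u.1 * p ∧ (w.1 = v.1 * p ∨ w.1 = v.1 * q⁻¹)) ∨
      (v.1 = u.1 * q ∧ (w.1 = v.1 * q ∨ w.1 = v.1 * p⁻¹))) := by
  rw [lineDigraphGraph_adj] at huw hvw
  obtain ⟨x, i, hi⟩ := u
  obtain ⟨y, j, hj⟩ := v
  obtain ⟨z, k, hk⟩ := w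
  have h1 := h.left_ne_one
  have h2 := h.right_ne_one
  have h3 := h.qpp
  have h4 := h.pqq
  have h5 := h.pqp
  have h6 := h.qpq
  clear h
  simp only [ArcRel, CayleyRel, ne_eq, Prod.mk.injEq, Fin.mk.injEq] at *
  obtain ⟨hne1, huw⟩ := huw
  obtain ⟨hne2, hvw⟩ := hvw
  have hxy : x ≠ y := by
    rintro rfl
    simp [h1, h2] at huv
  have hk2 : k = 2 := by
    by_contra hk2
    have e1 : x = z := huw.resolve_right (by omega)
    have e2 : y = z := hvw.resolve_right (by omega)
    exact hxy (e1.trans e2.symm)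
  subst hk2
  have hw : (z = y * p ∨ z = y * q ∨ y = z * p ∨ y = z * q) ∧
      (z = x * p ∨ z = x * q ∨ x = z * p ∨ x = z * q) := by
    clear h3 h4 h5 h6
    grind
  clear hne1 huw hne2 hvw
  simp only [eq_mul_inv_iff_mul_eq]
  obtain ⟨-, -, rfl | rfl⟩ := huv <;> obtain ⟨hw1, hw2⟩ := hw
  · refine ⟨trivial, .inl ⟨rfl, ?_⟩⟩
    rcases hw1 with rfl | rfl | hw1 | hw1
    · exact .inl rfl
    · simp only [mul_assoc] at *
      simp [h1, h2, h4, h5] at hw2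
    · obtain rfl := mul_right_cancel hw1
      simp [h1, h2] at hw2
    · exact .inr hw1.symm
  · refine ⟨trivial, .inr ⟨rfl, ?_⟩⟩
    rcases hw1 with rfl | rfl | hw1 | hw1
    · simp only [mul_assoc] at *
      simp [h1, h2, h3, h6] at hw2
    · exact .inl rfl
    · exact .inr hw1.symm
    · obtain rfl := mul_right_cancel hw1
      simp [h1, h2] at hw2

omit h in
theorem common_neighbour_of_block {u v w : G × Fin m} (huv : u.1 = v.1) (hu : u.2.1 ≤ 1)
    (hv : v.2.1 = 2) (huw : (lineDigraphGraph p q m).Adj u w)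
    (hvw : (lineDigraphGraph p q m).Adj v w) (hm : m ≤ 3) : MateRel u w := by
  rw [lineDigraphGraph_adj] at huw hvw
  obtain ⟨x, i, hi⟩ := u
  obtain ⟨y, j, hj⟩ := v
  obtain ⟨z, k, hk⟩ := w
  simp only [ArcRel, CayleyRel, MateRel, ne_eq, Prod.mk.injEq, Fin.mk.injEq] at *
  subst huv hv
  obtain ⟨hne1, huw⟩ := huw
  obtain ⟨hne2, hvw⟩ := hvw
  have : x = z := by
    by_contra hxz
    have e1 := huw.resolve_left hxz
    have e2 := hvw.resolve_left hxz
    omega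
  subst this
  simp only [true_and] at *
  omega

end IsLinePair

omit [Group G] in
theorem MateRel.symm {u v : G × Fin m} (h : MateRel u v) : MateRel v u :=
  ⟨h.1.symm, by rw [add_comm]; exact h.2⟩

omit [Group G] in
theorem MateRel.unique {u v w : G × Fin m} (hv : MateRel u v) (hw : MateRel u w) : v = w :=
  Prod.ext (hv.1.symm.trans hw.1) (Fin.ext (by have := hv.2; have := hw.2; omega))

theorem ArcRel.unique_left {p q : G} (hpq : p ≠ q) {u v w₁ w₂ : G × Fin m}
    (h1 : ArcRel p q v w₁) (h1' : ArcRel p q w₁ u) (h2 : ArcRel p q v w₂)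
    (h2' : ArcRel p q w₂ u) : w₁ = w₂ := by
  obtain ⟨x, i, hi⟩ := u
  obtain ⟨y, j, hj⟩ := v
  obtain ⟨z, k, hk⟩ := w₁
  obtain ⟨z', k', hk'⟩ := w₂
  simp only [ArcRel, Prod.mk.injEq, Fin.mk.injEq] at *
  obtain rfl : z = z' := by
    rcases h1'.2 with ⟨e, h1'⟩ | ⟨e, h1'⟩ <;> rcases h2'.2 with ⟨e', h2'⟩ | ⟨e', h2'⟩
    · exact mul_right_cancel (h1'.symm.trans h2')
    · omega
    · omega
    · exact mul_right_cancel (h1'.symm.trans h2')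
  refine ⟨rfl, ?_⟩
  rcases h1.2 with ⟨e, h1⟩ | ⟨e, h1⟩ <;> rcases h2.2 with ⟨e', h2⟩ | ⟨e', h2⟩
  · omega
  · exact absurd (mul_left_cancel (h1.symm.trans h2)) hpq
  · exact absurd (mul_left_cancel (h1.symm.trans h2)).symm hpq
  · omega

namespace IsLinePair

variable {p q : G} (h : IsLinePair p q)
include h

theorem not_arc_of_inThreeTriangles {u v : G × Fin m}
    (huv : InThreeTriangles (lineDigraphGraph p q m) u v) : ¬ ArcRel p q u v := by
  intro ha
  obtain ⟨-, w₁, w₂, w₃, ⟨h12, h13, h23⟩, h1, h2, h3⟩ := huv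
  have key : ∀ {w w'}, ArcRel p q v w ∧ ArcRel p q w u → ArcRel p q v w' ∧ ArcRel p q w' u →
      w = w' := fun e e' => ArcRel.unique_left h.ne e.1 e.2 e'.1 e'.2
  rcases h.common_neighbour_of_arc ha h1.1 h1.2 with e1 | e1 <;>
  rcases h.common_neighbour_of_arc ha h2.1 h2.2 with e2 | e2 <;>
  rcases h.common_neighbour_of_arc ha h3.1 h3.2 with e3 | e3
  exacts [h12 (e1.unique e2), h12 (e1.unique e2), h13 (e1.unique e3), h23 (key e2 e3),
    h23 (e2.unique e3), h13 (key e1 e3), h12 (key e1 e2), h12 (key e1 e2)]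

theorem not_cayley_of_inThreeTriangles {u v : G × Fin m}
    (huv : InThreeTriangles (lineDigraphGraph p q m) u v) : ¬ CayleyRel p q u v := by
  intro ha
  obtain ⟨-, w₁, w₂, w₃, ⟨h12, h13, h23⟩, h1, h2, h3⟩ := huv
  have e1 := h.common_neighbour_of_cayley ha h1.1 h1.2
  have e2 := h.common_neighbour_of_cayley ha h2.1 h2.2
  have e3 := h.common_neighbour_of_cayley ha h3.1 h3.2
  have hne : ¬ (v.1 = u.1 * p ∧ v.1 = u.1 * q) := fun e =>
    h.ne (mul_left_cancel (e.1.symm.trans e.2))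
  simp only [ne_eq, Prod.ext_iff, Fin.ext_iff] at h12 h13 h23
  clear h
  grind

theorem mateRel_iff_inThreeTriangles {u v : G × Fin 3} :
    MateRel u v ↔ InThreeTriangles (lineDigraphGraph p q 3) u v := by
  have h1 := h.left_ne_one
  have h2 := h.right_ne_one
  constructor
  · intro huv
    obtain ⟨x, i⟩ := u
    obtain ⟨y, j⟩ := v
    obtain ⟨rfl, hij⟩ := huv
    dsimp only at hij
    have hij' : (i = 0 ∧ j = 1) ∨ (i = 1 ∧ j = 0) := by omega
    simp only [InThreeTriangles, lineDigraphGraph_adj, ArcRel, CayleyRel]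
    refine ⟨by grind, (x, 2), (x * p, 0), (x * q, 1), by simp [h1, h2], ?_⟩
    rcases hij' with ⟨rfl, rfl⟩ | ⟨rfl, rfl⟩ <;> simp [h1, h2]
  · intro huv
    have hvu : InThreeTriangles (lineDigraphGraph p q 3) v u := by
      obtain ⟨h, w₁, w₂, w₃, hne, h1, h2, h3⟩ := huv
      exact ⟨h.symm, w₁, w₂, w₃, hne, h1.symm, h2.symm, h3.symm⟩
    rcases lineDigraphGraph_adj.1 huv.1 with ⟨hne, e | e | e | e | e⟩
    · have hne' : u.2.1 ≠ v.2.1 := fun e' => hne (Prod.ext e (Fin.ext e'))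
      rcases (by omega : u.2.1 + v.2.1 = 1 ∨ (u.2.1 ≤ 1 ∧ v.2.1 = 2) ∨ (v.2.1 ≤ 1 ∧ u.2.1 = 2))
        with e' | e' | e'
      · exact ⟨e, e'⟩
      · obtain ⟨-, w₁, w₂, w₃, hne, h1, h2, h3⟩ := huv
        exact absurd ((common_neighbour_of_block e e'.1 e'.2 h1.1 h1.2 le_rfl).unique
          (common_neighbour_of_block e e'.1 e'.2 h2.1 h2.2 le_rfl)) hne.1
      · obtain ⟨-, w₁, w₂, w₃, hne, h1, h2, h3⟩ := hvu
        exact absurd ((common_neighbour_of_block e.symm e'.1 e'.2 h1.1 h1.2 le_rfl).unique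
          (common_neighbour_of_block e.symm e'.1 e'.2 h2.1 h2.2 le_rfl)) hne.1
    · exact absurd e (h.not_arc_of_inThreeTriangles huv)
    · exact absurd e (h.not_arc_of_inThreeTriangles hvu)
    · exact absurd e (h.not_cayley_of_inThreeTriangles huv)
    · exact absurd e (h.not_cayley_of_inThreeTriangles hvu)

theorem inTwoTriangles_of_mateRel {u v : G × Fin m} (huv : MateRel u v) :
    InTwoTriangles (lineDigraphGraph p q m) u v := by
  have h1 := h.left_ne_one
  have h2 := h.right_ne_one
  obtain ⟨x, i, hi⟩ := u
  obtain ⟨y, j, hj⟩ := v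
  obtain ⟨rfl, hij⟩ := huv
  dsimp only at hij
  have hij' : (i = 0 ∧ j = 1) ∨ (i = 1 ∧ j = 0) := by omega
  simp only [InTwoTriangles, lineDigraphGraph_adj, ArcRel, CayleyRel]
  refine ⟨by grind, (x * p, ⟨0, by omega⟩), (x * q, ⟨1, by omega⟩), by simp, ?_⟩
  rcases hij' with ⟨rfl, rfl⟩ | ⟨rfl, rfl⟩ <;> simp [h1, h2]

theorem eq_zero_of_arc_of_inTwoTriangles {u v : G × Fin m} (huv : ArcRel p q u v)
    (ht : InTwoTriangles (lineDigraphGraph p q m) u v) : u.2.1 = 0 ∧ v.2.1 = 0 := by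
  have key : ∀ w, ArcRel p q v w → ArcRel p q w u → u.2.1 = 0 ∧ v.2.1 = 0 := by
    intro w hvw hwu
    have h1 := h.ppq
    have h2 := h.pqq
    have h3 := h.qqq
    have h4 := h.pqp
    have h5 := h.qpq
    have h6 := h.qpp
    have h7 := h.qqp
    clear h
    obtain ⟨x, i, hi⟩ := u
    obtain ⟨y, j, hj⟩ := v
    obtain ⟨z, k, hk⟩ := w
    simp only [ArcRel] at huv hvw hwu ⊢
    obtain ⟨-, ⟨rfl, rfl⟩ | ⟨rfl, rfl⟩⟩ := huv <;> obtain ⟨-, ⟨rfl, rfl⟩ | ⟨rfl, rfl⟩⟩ := hvw <;>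
    obtain ⟨-, ⟨rfl, hwu⟩ | ⟨rfl, hwu⟩⟩ := hwu <;> first
    | exact ⟨rfl, rfl⟩
    | (rw [mul_assoc, mul_assoc, left_eq_mul, ← mul_assoc] at hwu
       contradiction)
  obtain ⟨-, w₁, w₂, hne, e1, e2⟩ := ht
  rcases h.common_neighbour_of_arc huv e1.1 e1.2 with e1 | e1
  · rcases h.common_neighbour_of_arc huv e2.1 e2.2 with e2 | e2
    · exact absurd (e1.unique e2) hne
    · exact key _ e2.1 e2.2
  · exact key _ e1.1 e1.2

theorem mateRel_or_of_inTwoTriangles {u v : G × Fin 2}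
    (ht : InTwoTriangles (lineDigraphGraph p q 2) u v) :
    MateRel u v ∨ (u.2.1 = 0 ∧ v.2.1 = 0) := by
  rcases lineDigraphGraph_adj.1 ht.1 with ⟨hne, e | e | e | e | e⟩
  · have hne' : u.2.1 ≠ v.2.1 := fun e' => hne (Prod.ext e (Fin.ext e'))
    exact .inl ⟨e, by omega⟩
  · exact .inr (h.eq_zero_of_arc_of_inTwoTriangles e ht)
  · exact .inr (h.eq_zero_of_arc_of_inTwoTriangles e ht.symm).symm
  · have := e.1
    omega
  · have := e.1
    omega

theorem mateRel_iff_inTwoTriangles {u v : G × Fin 2} :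
    MateRel u v ↔ InTwoTriangles (lineDigraphGraph p q 2) u v ∧
      ((∀ w, InTwoTriangles (lineDigraphGraph p q 2) u w → w = v) ∨
        ∀ w, InTwoTriangles (lineDigraphGraph p q 2) v w → w = u) := by
  constructor
  · intro huv
    refine ⟨h.inTwoTriangles_of_mateRel huv, ?_⟩
    have := huv.2
    rcases (by omega : u.2.1 = 1 ∨ v.2.1 = 1) with e | e
    · refine .inl fun w hw => ?_
      rcases h.mateRel_or_of_inTwoTriangles hw with e' | e'
      · exact e'.unique huv
      · omega
    · refine .inr fun w hw => ?_
      rcases h.mateRel_or_of_inTwoTriangles hw with e' | e'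
      · exact e'.unique huv.symm
      · omega
  · rintro ⟨ht, hu⟩
    have mate : ∀ u : G × Fin 2, ∃ v, MateRel u v := fun u =>
      ⟨(u.1, ⟨1 - u.2.1, by omega⟩), rfl, by dsimp only; omega⟩
    rcases hu with hu | hu
    · obtain ⟨w, hw⟩ := mate u
      rwa [← hu w (h.inTwoTriangles_of_mateRel hw)]
    · obtain ⟨w, hw⟩ := mate v
      rw [← hu w (h.inTwoTriangles_of_mateRel hw)]
      exact hw.symm

theorem mateRel_apply_iff (hm : m = 2 ∨ m = 3) {σ : Equiv.Perm (G × Fin m)}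
    (hσ : IsGraphAut (lineDigraphGraph p q m) σ) {u v : G × Fin m} :
    MateRel (σ u) (σ v) ↔ MateRel u v := by
  rcases hm with rfl | rfl
  · rw [h.mateRel_iff_inTwoTriangles, h.mateRel_iff_inTwoTriangles, hσ.inTwoTriangles_iff]
    refine and_congr_right' (or_congr ?_ ?_) <;>
    · refine σ.surjective.forall.trans (forall_congr' fun w => ?_)
      rw [hσ.inTwoTriangles_iff, σ.injective.eq_iff]
  · rw [h.mateRel_iff_inThreeTriangles, h.mateRel_iff_inThreeTriangles, hσ.inThreeTriangles_iff]

end IsLinePair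

variable {p q : G} (h : IsLinePair p q)
include h

namespace IsLinePair

theorem fst_eq_of_adj_mates {z : G} {w : G × Fin m} (h0 : 0 < m) (h1 : 1 < m) (hne : w.1 ≠ z)
    (hw0 : (lineDigraphGraph p q m).Adj (z, ⟨0, h0⟩) w)
    (hw1 : (lineDigraphGraph p q m).Adj (z, ⟨1, h1⟩) w) :
    (w.2.1 = 0 ∧ w.1 = z * p) ∨ (w.2.1 = 1 ∧ w.1 = z * q) := by
  rw [lineDigraphGraph_adj] at hw0 hw1
  obtain ⟨y, k, hk⟩ := w
  have hpq := h.ne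
  clear h
  simp only [ArcRel, CayleyRel] at *
  rcases hw0.2 with e | e | ⟨-, e | e⟩ | e | e
  · exact absurd e.symm hne
  · exact e.2
  · rcases hw1.2 with e' | e' | ⟨-, e' | e'⟩ | e' | e'
    · exact absurd e'.symm hne
    · exact e'.2
    · omega
    · exact absurd (mul_left_cancel (e.2.symm.trans e'.2)) hpq
    · omega
    · omega
  · omega
  · omega
  · omega

theorem exists_leftTranslation (hm : m = 2 ∨ m = 3) {σ : Equiv.Perm (G × Fin m)}
    (hσ : IsGraphAut (lineDigraphGraph p q m) σ) : ∃ g : G, ∀ u, σ u = (g * u.1, u.2) := by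
  have h0 : 0 < m := by omega
  have h1 : 1 < m := by omega
  have hp := h.left_ne_one
  have hq := h.right_ne_one
  have hmate := fun u v => h.mateRel_apply_iff hm hσ (u := u) (v := v)
  set f : G → G := fun x => (σ (x, ⟨0, h0⟩)).1 with hf
  have hM : ∀ x, MateRel (σ (x, ⟨0, h0⟩)) (σ (x, ⟨1, h1⟩)) := fun x =>
    (hmate (x, ⟨0, h0⟩) (x, ⟨1, h1⟩)).2 ⟨rfl, rfl⟩
  have hfst : ∀ x, (σ (x, ⟨1, h1⟩)).1 = f x := fun x => (hM x).1.symm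
  have hpre : ∀ x (v : G × Fin m), v.1 = f x → v.2.1 ≤ 1 →
      v = σ (x, ⟨0, h0⟩) ∨ v = σ (x, ⟨1, h1⟩) := by
    intro x v hv hv'
    have := (hM x).2
    rcases (by omega : v.2.1 = (σ (x, ⟨0, h0⟩)).2.1 ∨ v.2.1 = (σ (x, ⟨1, h1⟩)).2.1) with e | e
    · exact .inl (Prod.ext hv (Fin.ext e))
    · exact .inr (Prod.ext (hv.trans (hfst x).symm) (Fin.ext e))
  have hinj : Function.Injective f := by
    intro x y hxy
    have := (hM y).2
    rcases hpre x (σ (y, ⟨0, h0⟩)) hxy.symm (by omega) with e | e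
    · simpa using (σ.injective e).symm
    · simpa using σ.injective e
  have himg : ∀ x w, (lineDigraphGraph p q m).Adj (x, ⟨0, h0⟩) w →
      (lineDigraphGraph p q m).Adj (x, ⟨1, h1⟩) w →
      (lineDigraphGraph p q m).Adj (f x, ⟨0, h0⟩) (σ w) ∧
      (lineDigraphGraph p q m).Adj (f x, ⟨1, h1⟩) (σ w) := by
    intro x w hw0 hw1
    constructor
    · rcases hpre x (f x, ⟨0, h0⟩) rfl (by simp) with e | e <;> rw [e]
      exacts [(hσ _ _).2 hw0, (hσ _ _).2 hw1]
    · rcases hpre x (f x, ⟨1, h1⟩) rfl le_rfl with e | e <;> rw [e]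
      exacts [(hσ _ _).2 hw0, (hσ _ _).2 hw1]
  have hP : ∀ x, ((σ (x * p, ⟨0, h0⟩)).2.1 = 0 ∧ f (x * p) = f x * p) ∨
      ((σ (x * p, ⟨0, h0⟩)).2.1 = 1 ∧ f (x * p) = f x * q) := by
    intro x
    have := himg x (x * p, ⟨0, h0⟩) (by simp [lineDigraphGraph_adj, ArcRel, hp])
      (by simp [lineDigraphGraph_adj, ArcRel, hp])
    exact h.fst_eq_of_adj_mates h0 h1 (hinj.ne (by simp [hp])) this.1 this.2
  have hQ : ∀ x, ((σ (x * q, ⟨1, h1⟩)).2.1 = 0 ∧ f (x * q) = f x * p) ∨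
      ((σ (x * q, ⟨1, h1⟩)).2.1 = 1 ∧ f (x * q) = f x * q) := by
    intro x
    have := himg x (x * q, ⟨1, h1⟩) (by simp [lineDigraphGraph_adj, ArcRel, hq])
      (by simp [lineDigraphGraph_adj, ArcRel, hq])
    rw [← hfst (x * q)]
    exact h.fst_eq_of_adj_mates h0 h1 (by rw [hfst]; exact hinj.ne (by simp [hq])) this.1 this.2
  have hpq : ∀ x, f (x * p) ≠ f (x * q) := fun x => hinj.ne (by simp [h.ne])
  have hfp : ∀ x, f (x * p) = f x * p := h.map_mul_left f fun x => by
    rcases hP x with e | e <;> rcases hQ x with e' | e'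
    · exact absurd (e.2.trans e'.2.symm) (hpq x)
    · exact .inl ⟨e.2, e'.2⟩
    · exact .inr ⟨e.2, e'.2⟩
    · exact absurd (e.2.trans e'.2.symm) (hpq x)
  have hQ' : ∀ x, (σ (x * q, ⟨1, h1⟩)).2.1 = 1 ∧ f (x * q) = f x * q := fun x =>
    (hQ x).resolve_left fun e => hpq x ((hfp x).trans e.2.symm)
  have hmul := map_mul_of_closure_eq_top h.closure_eq_top (f := f) (by
    rintro g (rfl | rfl) x
    exacts [hfp x, (hQ' x).2])
  have hone : ∀ x, σ (x, ⟨1, h1⟩) = (f x, ⟨1, h1⟩) := fun x =>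
    Prod.ext (hfst x) (Fin.ext (by simpa using (hQ' (x * q⁻¹)).1))
  have hzero : ∀ x, σ (x, ⟨0, h0⟩) = (f x, ⟨0, h0⟩) := fun x =>
    Prod.ext rfl (Fin.ext (by
      have := (hM x).2
      have := congrArg (fun u => u.2.1) (hone x)
      dsimp only at *
      omega))
  refine ⟨f 1, ?_⟩
  rintro ⟨x, k, hk⟩
  rw [← hmul]
  rcases (by omega : k = 0 ∨ k = 1 ∨ k = 2) with rfl | rfl | rfl
  · exact hzero x
  · exact hone x
  have himg := (himg x (x, ⟨2, hk⟩) (by simp [lineDigraphGraph_adj])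
    (by simp [lineDigraphGraph_adj])).1
  have h2 : (σ (x, ⟨2, hk⟩)).2.1 = 2 := by
    by_contra hcon
    have hlt := (σ (x, ⟨2, hk⟩)).2.2
    have hx : (σ (x, ⟨2, hk⟩)).1 = f ((f 1)⁻¹ * (σ (x, ⟨2, hk⟩)).1) := by
      rw [hmul, mul_inv_cancel_left]
    rcases hpre _ _ hx (by omega) with e | e <;> simpa using σ.injective e
  refine Prod.ext ?_ (Fin.ext h2)
  rcases (lineDigraphGraph_adj.1 himg).2 with e | e | e | e | e
  · exact e.symm
  · have := e.2
    omega
  · have := e.1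
    omega
  · have := e.1
    simp at this
  · have := e.2.1
    simp at this

theorem ncard_neighborSet (hm : m = 2 ∨ m = 3) (i : Fin m) :
    ((lineDigraphGraph p q m).neighborSet (1, i)).ncard = m + 3 := by
  classical
  have h1 := h.left_ne_one
  have h2 := h.right_ne_one
  have h3 := h.ne
  have h3' := h.ne.symm
  have h4 : p⁻¹ ≠ p := fun e => h.left_sq (mul_eq_one_iff_inv_eq.2 e)
  have h5 : q⁻¹ ≠ q := fun e => h.right_sq (mul_eq_one_iff_inv_eq.2 e)
  have h6 : p⁻¹ ≠ q := fun e => h.mul_ne (mul_eq_one_iff_inv_eq.2 e)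
  have h7 : q⁻¹ ≠ p := fun e => h.mul_ne' (mul_eq_one_iff_inv_eq.2 e)
  have key : ∀ s : Finset (G × Fin m), (∀ v, (lineDigraphGraph p q m).Adj (1, i) v ↔ v ∈ s) →
      ((lineDigraphGraph p q m).neighborSet (1, i)).ncard = s.card := by
    intro s hs
    rw [← Set.ncard_coe_finset]
    congr 1
    ext v
    exact hs v
  simp only [lineDigraphGraph_adj, ArcRel, CayleyRel, eq_comm (a := (1 : G)) (b := _ * _),
    mul_eq_one_iff_eq_inv, one_mul] at key
  clear h
  have h8 := inv_ne_one.2 h1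
  have h9 := inv_ne_one.2 h2
  have h10 := inv_injective.ne h3
  have h11 := h10.symm
  have h1' := h1.symm
  have h2' := h2.symm
  have h4' := h4.symm
  have h5' := h5.symm
  have h6' := h6.symm
  have h7' := h7.symm
  have h8' := h8.symm
  have h9' := h9.symm
  rcases hm with rfl | rfl
  · fin_cases i
    · refine (key {(1, 1), (p, 0), (q, 1), (p⁻¹, 0), (p⁻¹, 1)} ?_).trans ?_ <;> clear key
      · rintro ⟨y, j⟩
        fin_cases j <;> simp <;> grind
      · simp [*]
    · refine (key {(1, 0), (p, 0), (q, 1), (q⁻¹, 0), (q⁻¹, 1)} ?_).trans ?_ <;> clear key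
      · rintro ⟨y, j⟩
        fin_cases j <;> simp <;> grind
      · simp [*]
  · fin_cases i
    · refine (key {(1, 1), (1, 2), (p, 0), (q, 1), (p⁻¹, 0), (p⁻¹, 1)} ?_).trans ?_ <;> clear key
      · rintro ⟨y, j⟩
        fin_cases j <;> simp <;> grind
      · simp [*]
    · refine (key {(1, 0), (1, 2), (p, 0), (q, 1), (q⁻¹, 0), (q⁻¹, 1)} ?_).trans ?_ <;> clear key
      · rintro ⟨y, j⟩
        fin_cases j <;> simp <;> grind
      · simp [*]
    · refine (key {(1, 0), (1, 1), (p, 2), (q, 2), (p⁻¹, 2), (q⁻¹, 2)} ?_).trans ?_ <;> clear key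
      · rintro ⟨y, j⟩
        fin_cases j <;> simp <;> grind
      · simp [*]

end IsLinePair

end DoubledArc

theorem IsLinePair.hasMGRR {G : Type} [Group G] [Finite G] {p q : G} (h : IsLinePair p q) {m : ℕ}
    (hm : m = 2 ∨ m = 3) : HasMGRR G m := by
  refine hasMGRR_of_graph (by omega) (lineDigraphGraph p q m) (fun g u v => ?_) (m + 3)
    (h.ncard_neighborSet hm) fun σ hσ => h.exists_leftTranslation hm hσ
  simp [lineDigraphGraph_adj, ArcRel, CayleyRel, mul_assoc, Prod.ext_iff]

theorem closure_pair_map_eq_top {G H : Type*} [Group G] [Group H] (e : G ≃* H) {a b : G}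
    (h : Subgroup.closure {a, b} = ⊤) : Subgroup.closure {e a, e b} = ⊤ := by
  have := congrArg (Subgroup.map e.toMonoidHom) h
  rw [MonoidHom.map_closure, Subgroup.map_top_of_surjective _ e.surjective] at this
  simpa [Set.image_pair] using this

theorem IsLinkPair.map {G H : Type*} [Group G] [Group H] (e : G ≃* H) {a b : G}
    (h : IsLinkPair a b) : IsLinkPair (e a) (e b) where
  closure_eq_top := closure_pair_map_eq_top e h.closure_eq_top
  sq_ne he := h.sq_ne (e.injective (by simpa using he))
  cube_ne he := h.cube_ne (e.injective (by simpa using he))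
  right_ne_one he := h.right_ne_one (e.injective (by simpa using he))
  ne he := h.ne (e.injective (by simpa using he))
  ne_inv he := h.ne_inv (e.injective (by simpa using he))

theorem IsLinePair.map {G H : Type*} [Group G] [Group H] (e : G ≃* H) {p q : G}
    (h : IsLinePair p q) : IsLinePair (e p) (e q) where
  closure_eq_top := closure_pair_map_eq_top e h.closure_eq_top
  ne he := h.ne (e.injective (by simpa using he))
  left_sq he := h.left_sq (e.injective (by simpa using he))
  right_sq he := h.right_sq (e.injective (by simpa using he))
  mul_ne he := h.mul_ne (e.injective (by simpa using he))
  ppq he := h.ppq (e.injective (by simpa using he))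
  pqq he := h.pqq (e.injective (by simpa using he))
  qqq he := h.qqq (e.injective (by simpa using he))
  map_mul_left f hf x := by
    have := h.map_mul_left (fun y => e.symm (f (e y))) (fun y => by
      simpa [MulEquiv.symm_apply_eq] using hf (e y)) (e.symm x)
    simpa [MulEquiv.symm_apply_eq] using this

theorem hasMGRR_of_pairs {G : Type*} [Group G] [Finite G] {a b p q : G} (h : IsLinkPair a b)
    (h' : IsLinePair p q) {m : ℕ} (hm : 2 ≤ m) : HasMGRR G m := by
  let e : G ≃* Shrink.{0} G := Shrink.mulEquiv.symm
  refine HasMGRR.of_mulEquiv e ?_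
  rcases (by omega : (m = 2 ∨ m = 3) ∨ 4 ≤ m) with hm | hm
  · exact (h'.map e).hasMGRR hm
  · exact (h.map e).hasMGRR hm

section Cyclic

variable {G : Type*} [Group G] {g : G} (hg : Subgroup.closure {g} = ⊤) (hk : 6 ≤ orderOf g)
include hg hk

theorem isLinkPair_sq : IsLinkPair g (g * g) := by
  have h : ∀ k, 0 < k → k < 6 → g ^ k ≠ 1 := fun k h0 h6 =>
    pow_ne_one_of_lt_orderOf h0.ne' (by omega)
  refine ⟨top_le_iff.1 (hg ▸ Subgroup.closure_mono (by simp)), fun e => h 2 (by simp) (by simp) ?_,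
    fun e => h 3 (by simp) (by simp) ?_, fun e => h 2 (by simp) (by simp) ?_,
    fun e => h 1 (by simp) (by simp) ?_, fun e => h 3 (by simp) (by simp) ?_⟩
  · rw [pow_two, e]
  · rw [pow_three', e]
  · rw [pow_two, e]
  · simpa using e
  · rw [pow_three', e, inv_mul_cancel]

theorem isLinePair_sq : IsLinePair (g * g) g := by
  have h : ∀ k, 0 < k → k < 6 → g ^ k ≠ 1 := fun k h0 h6 =>
    pow_ne_one_of_lt_orderOf h0.ne' (by omega)
  have h1 := h 1 (by simp) (by simp)
  have h2 := h 2 (by simp) (by simp)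
  have h3 := h 3 (by simp) (by simp)
  have h4 := h 4 (by simp) (by simp)
  have h5 := h 5 (by simp) (by simp)
  refine ⟨top_le_iff.1 (hg ▸ Subgroup.closure_mono (by simp)), fun e => h1 (by simpa using e),
    fun e => h4 ?_, fun e => h2 ?_, fun e => h3 ?_, fun e => h5 ?_, fun e => h4 ?_,
    fun e => h3 ?_, ?_⟩
  iterate 6 · rw [← e]; simp only [pow_succ, pow_zero, one_mul, mul_assoc]
  intro f hf x
  refine (hf x).elim And.left fun h' => ?_
  exfalso
  have e := h'.1
  rw [← mul_assoc] at e
  rcases hf (x * g) with e' | e' <;> have e'' := e'.2 <;>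
    rw [e, h'.2, mul_assoc (f x), mul_right_inj] at e''
  · exact h2 (by rw [pow_two]; exact mul_eq_right.1 e''.symm)
  · exact h3 (by rw [pow_three]; exact mul_eq_left.1 (by simpa only [mul_assoc] using e''.symm))

end Cyclic

section Dicyclic

/-- The standard generators of a dicyclic group of order at least `12`. -/
structure IsDicyclicPair {G : Type*} [Group G] (a x : G) : Prop where
  closure_eq_top : Subgroup.closure {a, x} = ⊤
  conj : x⁻¹ * a * x = a⁻¹
  left_sq : a * a ≠ 1
  left_cube : a * a * a ≠ 1
  left_four : a ^ 4 ≠ 1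
  right_sq : x * x ≠ 1
  right_four : x ^ 4 = 1

variable {G : Type*} [Group G] {a x : G}

namespace IsDicyclicPair

variable (h : IsDicyclicPair a x)
include h

theorem not_commute : ¬ Commute a x := fun hc => h.left_sq (by
  rw [mul_eq_one_iff_eq_inv]
  nth_rw 1 [← h.conj]
  rw [mul_assoc, hc.eq, inv_mul_cancel_left])

theorem ne_zpow (k : ℤ) : x ≠ a ^ k := fun e =>
  h.not_commute (e ▸ Commute.self_zpow a k)

theorem right_ne_zpow (k : ℤ) : a ≠ x ^ k := fun e =>
  h.not_commute (by rw [e]; exact (Commute.self_zpow x k).symm)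

theorem mul_mul_self : a * x * a = x := by
  have := h.conj
  rw [mul_assoc, inv_mul_eq_iff_eq_mul, eq_mul_inv_iff_mul_eq] at this
  exact this

theorem sq_inv : (x * x)⁻¹ = x * x := by
  rw [inv_eq_iff_mul_eq_one, ← h.right_four]
  simp only [pow_succ, pow_zero, one_mul, mul_assoc]

theorem sq_mul_sq_ne : a * a * (x * x) ≠ 1 := fun e => h.left_four (by
  rw [mul_eq_one_iff_eq_inv, h.sq_inv] at e
  calc a ^ 4 = (a * a) * (a * a) := by simp only [pow_succ, pow_zero, one_mul, mul_assoc]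
    _ = (x * x)⁻¹ * (x * x) := by rw [e, h.sq_inv]
    _ = 1 := inv_mul_cancel _)

theorem mul_sq : x * x * a = a * (x * x) := by
  have := h.mul_mul_self
  calc x * x * a = (a * x * a) * x * a := by rw [this]
    _ = a * x * (a * x * a) := by simp only [mul_assoc]
    _ = a * (x * x) := by rw [this, mul_assoc]

theorem isLinkPair : IsLinkPair a x where
  closure_eq_top := h.closure_eq_top
  sq_ne := h.left_sq
  cube_ne := h.left_cube
  right_ne_one e := h.right_sq (by simp [e])
  ne e := h.ne_zpow 1 (by simp [e])
  ne_inv e := h.ne_zpow (-1) (by simp [e])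

theorem isLinePair : IsLinePair x a where
  closure_eq_top := by rw [Set.pair_comm]; exact h.closure_eq_top
  ne e := h.ne_zpow 1 (by simp [e])
  left_sq := h.right_sq
  right_sq := h.left_sq
  mul_ne e := h.ne_zpow (-1) (by simpa using eq_inv_of_mul_eq_one_left e)
  ppq e := h.right_ne_zpow (-2) (by
    rw [eq_inv_of_mul_eq_one_right e]; group)
  pqq e := h.ne_zpow (-2) (by
    rw [mul_assoc] at e
    rw [eq_inv_of_mul_eq_one_left e]; group)
  qqq := h.left_cube
  map_mul_left f hf y := by
    refine (hf y).elim And.left fun h' => ?_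
    exfalso
    have hx : ∀ z, f (z * x) = f z * x ∨ f (z * x) = f z * a := fun z =>
      (hf z).imp And.left And.left
    have h4 : y * x * x * x * x = y := by
      simpa only [pow_succ, pow_zero, one_mul, mul_assoc, mul_one] using
        congrArg (y * ·) h.right_four
    have a0 := h.left_four
    have a1 := h.ne_zpow (-3)
    have a2 := h.right_ne_zpow (-3)
    have a3 := h.sq_mul_sq_ne
    have e : ∀ r s t, f (y * x * x) = f (y * x) * r → f (y * x * x * x) = f (y * x * x) * s →
        f (y * x * x * x * x) = f (y * x * x * x) * t → a * r * s * t = 1 := by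
      intro r s t hr hs ht
      rw [h4, hs, hr, h'.1] at ht
      simpa only [mul_assoc, left_eq_mul] using ht
    rcases hx (y * x) with hr | hr <;> rcases hx (y * x * x) with hs | hs <;>
      rcases hx (y * x * x * x) with ht | ht <;> have e := e _ _ _ hr hs ht
    · have e' : a * (x * (x * x)) = 1 := by simpa only [mul_assoc] using e
      exact a2 (by rw [eq_inv_of_mul_eq_one_left e']; group)
    · rw [mul_assoc a, ← h.mul_sq, mul_assoc, ← h.sq_inv, inv_mul_eq_one] at e
      exact a3 (by rw [← e]; exact inv_eq_iff_mul_eq_one.1 h.sq_inv)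
    · rw [h.mul_mul_self] at e
      exact h.right_sq e
    · rw [h.mul_mul_self] at e
      exact h.ne_zpow (-1) (by simpa using eq_inv_of_mul_eq_one_left e)
    · exact a3 (by simpa only [mul_assoc] using e)
    · rw [mul_assoc a, mul_assoc a, h.mul_mul_self] at e
      exact h.ne_zpow (-1) (by simpa using eq_inv_of_mul_eq_one_right e)
    · exact a1 (by rw [eq_inv_of_mul_eq_one_right e]; group)
    · exact a0 (by simpa only [pow_succ, pow_zero, one_mul] using e)

end IsDicyclicPair

/-- A group generated by `a` of order `4` and `x` with `x * x = a ^ 2` inverting `a` is the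
quaternion group. -/
theorem nonempty_mulEquiv_quaternionGroup (hc : Subgroup.closure {a, x} = ⊤)
    (hconj : x⁻¹ * a * x = a⁻¹) (ha : orderOf a = 4) (hx : x * x = a ^ 2) :
    Nonempty (G ≃* QuaternionGroup 2) := by
  let E : ZMod (2 * 2) →+ Additive G := ZMod.lift (2 * 2)
    ⟨zmultiplesHom (Additive G) (Additive.ofMul a), by
      have h4 : a ^ 4 = 1 := ha ▸ pow_orderOf_eq_one a
      rw [zmultiplesHom_apply, natCast_zsmul]
      exact congrArg Additive.ofMul h4⟩
  let F : ZMod (2 * 2) → G := fun i => (E i).toMul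
  have hF : ∀ k : ℤ, F k = a ^ k := fun k => by
    simp [F, E]
  have hadd : ∀ i j, F (i + j) = F i * F j := fun i j => by simp [F]
  have hneg : ∀ i, F (-i) = (F i)⁻¹ := fun i => by simp [F]
  have hinj : ∀ i, F i = 1 → i = 0 := by
    intro i hi
    obtain ⟨k, rfl⟩ := ZMod.intCast_surjective i
    rw [hF, ← orderOf_dvd_iff_zpow_eq_one, ha] at hi
    exact (ZMod.intCast_zmod_eq_zero_iff_dvd k 4).2 hi
  have hFx : ∀ i, F i * x = x * F (-i) := by
    intro i
    obtain ⟨k, rfl⟩ := ZMod.intCast_surjective i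
    have : SemiconjBy x a⁻¹ a := by
      rw [SemiconjBy, ← hconj]; group
    rw [hneg, hF, ← inv_zpow]
    exact (this.zpow_right k).eq.symm
  have hxx : x * x = F 2 := by
    rw [hx]
    exact_mod_cast (hF 2).symm
  have hne : ∀ i, x * F i ≠ 1 := by
    intro i hi
    obtain ⟨k, rfl⟩ := ZMod.intCast_surjective i
    rw [hF] at hi
    have hcomm : Commute x a := by
      rw [eq_inv_of_mul_eq_one_left hi]
      exact ((Commute.refl a).zpow_left k).inv_left
    rw [mul_assoc, ← hcomm.eq, inv_mul_cancel_left, ← mul_eq_one_iff_eq_inv, ← pow_two] at hconj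
    have := Nat.le_of_dvd (by simp) (orderOf_dvd_of_pow_eq_one hconj)
    omega
  let φ : QuaternionGroup 2 →* G :=
    MonoidHom.mk' (fun | .a i => F i | .xa i => x * F i) (by
      rintro (i | i) (j | j)
      · exact hadd i j
      · change x * F (j - i) = F i * (x * F j)
        rw [← mul_assoc, hFx, mul_assoc, ← hadd, sub_eq_neg_add]
      · change x * F (i + j) = x * F i * F j
        rw [hadd, mul_assoc]
      · change F (2 + j - i) = x * F i * (x * F j)
        rw [mul_assoc, ← mul_assoc (F i), hFx, mul_assoc x, ← hadd, ← mul_assoc, hxx, ← hadd]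
        congr 1
        ring)
  have hφ : Function.Bijective φ := by
    constructor
    · rw [injective_iff_map_eq_one]
      rintro (i | i) hi
      · rw [hinj i hi]
        rfl
      · exact absurd hi (hne i)
    · rw [← MonoidHom.range_eq_top, ← top_le_iff, ← hc, Subgroup.closure_le]
      rintro _ (rfl | rfl)
      · exact ⟨.a 1, by simpa [φ] using hF 1⟩
      · exact ⟨.xa 0, by simpa [φ] using hF 0⟩
  exact ⟨(MulEquiv.ofBijective φ hφ).symm⟩

theorem IsDicyclic.exists_isDicyclicPair (h : IsDicyclic G)
    (hq : ¬ Nonempty (G ≃* QuaternionGroup 2)) : ∃ a x : G, IsDicyclicPair a x := by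
  obtain ⟨A, x, hA, ⟨b, hb, hbb⟩, hxA, hx2, hx4, hconj, hc⟩ := h
  obtain ⟨⟨a, haA⟩, ha⟩ := hA.exists_generator
  have hgen : ∀ c ∈ A, ∃ k : ℤ, a ^ k = c := by
    intro c hc
    obtain ⟨k, hk⟩ := ha ⟨c, hc⟩
    exact ⟨k, by simpa using congrArg Subtype.val hk⟩
  have hclos : Subgroup.closure {a, x} = ⊤ := by
    rw [← top_le_iff, ← hc, Subgroup.closure_le]
    rintro c (hc | rfl)
    · obtain ⟨k, rfl⟩ := hgen c hc
      exact Subgroup.zpow_mem _ (Subgroup.subset_closure (by simp)) k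
    · exact Subgroup.subset_closure (by simp)
  have ha2 : a ^ 2 ≠ 1 := by
    intro e
    obtain ⟨k, rfl⟩ := hgen b hb
    refine hbb ?_
    rw [← zpow_add, ← two_mul, zpow_mul]
    simp [e]
  obtain ⟨k, hk⟩ := hgen _ hxA
  refine ⟨a, x, hclos, hconj a haA, by rwa [← pow_two], fun e => hx2 ?_, fun e => hq ?_,
    by rwa [← pow_two], hx4⟩
  · have h3 : (x ^ 2) ^ 3 = 1 := by
      rw [← hk, ← zpow_natCast, ← zpow_mul, mul_comm, zpow_mul, zpow_natCast, pow_three', e,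
        one_zpow]
    rw [← pow_mul, show 2 * 3 = 4 + 2 from rfl, pow_add, hx4, one_mul] at h3
    exact h3
  · have ho : orderOf a = 4 := orderOf_eq_prime_pow (p := 2) (n := 1) (by simpa using ha2)
      (by simpa using e)
    refine nonempty_mulEquiv_quaternionGroup hclos (hconj a haA) ho ?_
    have h1 : a ^ (k * 2) = 1 := by
      rw [zpow_mul, hk, ← hx4, ← zpow_natCast, ← zpow_natCast, ← zpow_mul]
      rfl
    rw [← orderOf_dvd_iff_zpow_eq_one, ho] at h1
    have h2 : ¬ (4 : ℤ) ∣ k := by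
      intro h2
      exact hx2 (hk ▸ orderOf_dvd_iff_zpow_eq_one.1 (by rw [ho]; exact_mod_cast h2))
    rw [← pow_two, ← hk, ← zpow_natCast, ← orderOf_dvd_sub_iff_zpow_eq_zpow, ho]
    push_cast at *
    omega

end Dicyclic

/-- for `m ≥ 2`, a cyclic group of order at least 6 admits an m-GRR, and a
dicyclic group not isomorphic to `Q₈` admits an m-GRR. -/
theorem statement_12 (m : ℕ) (hm : 2 ≤ m) (G : Type*) [Group G] [Finite G] :
    (IsCyclic G → 6 ≤ Nat.card G → HasMGRR G m) ∧
    (IsDicyclic G → ¬ Nonempty (G ≃* QuaternionGroup 2) → HasMGRR G m) := by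
  constructor
  · intro hG hcard
    obtain ⟨g, hg⟩ := hG.exists_generator
    have hc : Subgroup.closure {g} = ⊤ := by
      rw [← Subgroup.zpowers_eq_closure]
      exact (Subgroup.eq_top_iff' _).2 hg
    rw [← orderOf_eq_card_of_forall_mem_zpowers hg] at hcard
    exact hasMGRR_of_pairs (isLinkPair_sq hc hcard) (isLinePair_sq hc hcard) hm
  · intro hG hq
    obtain ⟨a, x, h⟩ := hG.exists_isDicyclicPair hq
    exact hasMGRR_of_pairs h.isLinkPair h.isLinePair hm
end

section
/- For cyclic groups of order less than 6: (1) the trivial group has an m-GRR if and only if m = 1 or m ≥ 10; (2) the cyclic group of order 2 has an m-GRR if and only if m = 1 or m ≥ 5; (3) the cyclic group of order 3 has an m-GRR if and only if m ≥ 4; (4) the cyclic groups of order 4 and of order 5 have an m-GRR if and only if m ≥ 3. -/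
/-- The graph on `ZMod k × Fin m` in which `(a, i)` and `(b, j)` are adjacent when the
translation-invariant relation `E i j (b - a)` holds. -/
def liftGraph {k m : ℕ} (E : Fin m → Fin m → ZMod k → Prop)
    (hs : ∀ i j t, E i j t → E j i (-t)) (hi : ∀ i, ¬ E i i 0) :
    SimpleGraph (ZMod k × Fin m) where
  Adj u v := E u.2 v.2 (v.1 - u.1)
  symm := ⟨fun u v h => by simpa using hs _ _ _ h⟩
  loopless := ⟨fun u h => hi u.2 (by simpa using h)⟩

/-- The translation action of `ZMod k` on `ZMod k × Fin m`. -/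
def translation (k m : ℕ) : Multiplicative (ZMod k) →* Equiv.Perm (ZMod k × Fin m) where
  toFun g := (Equiv.addLeft g.toAdd).prodCongr (Equiv.refl _)
  map_one' := by ext v <;> simp
  map_mul' g h := by ext v <;> simp [add_assoc]

@[simp]
theorem translation_apply {k m : ℕ} (g : Multiplicative (ZMod k)) (v : ZMod k × Fin m) :
    translation k m g v = (g.toAdd + v.1, v.2) := rfl

theorem IsGraphAut.mul {V : Type*} {Γ : SimpleGraph V} {σ τ : Equiv.Perm V}
    (hσ : IsGraphAut Γ σ) (hτ : IsGraphAut Γ τ) : IsGraphAut Γ (σ * τ) :=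
  fun u v => (hσ _ _).trans (hτ u v)

theorem IsGraphAut.inv {V : Type*} {Γ : SimpleGraph V} {σ : Equiv.Perm V}
    (hσ : IsGraphAut Γ σ) : IsGraphAut Γ σ⁻¹ := fun u v => by
  simpa using (hσ (σ⁻¹ u) (σ⁻¹ v)).symm

section Lift

variable {k m : ℕ} {E : Fin m → Fin m → ZMod k → Prop}
  {hs : ∀ i j t, E i j t → E j i (-t)} {hi : ∀ i, ¬ E i i 0}

theorem isGraphAut_translation (g : Multiplicative (ZMod k)) :
    IsGraphAut (liftGraph E hs hi) (translation k m g) := fun u v => by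
  simp [liftGraph]

theorem hasMGRR_of_liftGraph [NeZero k] (hm : 1 ≤ m) (d : ℕ)
    (hd : ∀ v, ((liftGraph E hs hi).neighborSet v).ncard = d)
    (hr : ∀ σ, IsGraphAut (liftGraph E hs hi) σ → ∃ g : ZMod k, ∀ v, σ v = (g + v.1, v.2)) :
    HasMGRR (Multiplicative (ZMod k)) m := by
  refine ⟨ZMod k × Fin m, inferInstance, liftGraph E hs hi, translation k m, ⟨d, hd⟩,
    isGraphAut_translation, fun σ hσ => ?_, fun g h hgh => ?_, fun g v hv => ?_,
    fun i => (0, i), fun v => ⟨v.2, ⟨Multiplicative.ofAdd v.1, by simp⟩, ?_⟩⟩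
  · obtain ⟨g, hg⟩ := hr σ hσ
    exact ⟨Multiplicative.ofAdd g, Equiv.ext fun v => (hg v).symm⟩
  · have := congrArg (fun σ => (σ ((0 : ZMod k), (⟨0, hm⟩ : Fin m))).1) hgh
    simpa using this
  · have := congrArg Prod.fst hv
    simpa using this
  · rintro i ⟨g, hg⟩
    exact congrArg Prod.snd hg

end Lift

/-- Continuation passing that makes the kernel evaluate `n` to a literal first. -/
def withValue {α : Type*} (n : ℕ) (f : ℕ → α) : α :=
  match n with
  | 0 => f 0
  | k + 1 => f (k + 1)

theorem withValue_eq {α : Type*} (n : ℕ) (f : ℕ → α) : withValue n f = f n := by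
  cases n <;> rfl

/-- The sum of `g` over the entries of `l`. -/
def listSum (l : List ℕ) (g : ℕ → ℕ) : ℕ := l.foldr (fun u s => g u + s) 0

theorem listSum_eq (l : List ℕ) (g : ℕ → ℕ) : listSum l g = (l.map g).sum := by
  induction l with
  | nil => rfl
  | cons a l ih => simpa [listSum] using ih

/-- The neighbours of the vertex with code `v`, where the vertex `(a, i)` has code `i * k + a`
and `S` lists the codes of the neighbours of the vertices `(0, i)`. -/
def nbrCodes (S : List (List ℕ)) (k v : ℕ) : List ℕ :=
  (S.getD (v / k) []).map fun c => c / k * k + (c % k + v % k) % k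

/-- The colour of the vertex `v` in a colouring packed into a number, 32 bits per vertex. -/
def colour (C v : ℕ) : ℕ := C >>> (32 * v) % 4294967296

/-- Pack the colours `f v`, `v < n`, into a number, 32 bits per vertex. -/
def packColours (f : ℕ → ℕ) : ℕ → ℕ
  | 0 => 0
  | n + 1 => (f n % 4294967296) <<< (32 * n) + packColours f n

theorem packColours_lt (f : ℕ → ℕ) (n : ℕ) : packColours f n < 2 ^ (32 * n) := by
  induction n with
  | zero => simp [packColours]
  | succ n ih =>
    rw [packColours, Nat.shiftLeft_eq, Nat.mul_succ, pow_add]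
    have : f n % 4294967296 < 4294967296 := Nat.mod_lt _ (by norm_num)
    nlinarith [Nat.zero_le (2 ^ (32 * n))]

theorem colour_packColours (f : ℕ → ℕ) {n v : ℕ} (hv : v < n) :
    colour (packColours f n) v = f v % 4294967296 := by
  induction n with
  | zero => omega
  | succ n ih =>
    rw [colour, packColours, Nat.shiftLeft_eq, Nat.shiftRight_eq_div_pow]
    rcases (Nat.lt_succ_iff_lt_or_eq.mp hv) with h | rfl
    · rw [← ih h, colour, Nat.shiftRight_eq_div_pow]
      obtain ⟨e, rfl⟩ : ∃ e, n = v + 1 + e := ⟨n - (v + 1), by omega⟩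
      have : f (v + 1 + e) % 4294967296 * 2 ^ (32 * (v + 1 + e)) =
          (f (v + 1 + e) % 4294967296 * 2 ^ (32 * e) * 4294967296) * 2 ^ (32 * v) := by
        rw [show 32 * (v + 1 + e) = 32 * e + 32 + 32 * v by ring, pow_add, pow_add]
        norm_num
        ring
      rw [this, add_comm, Nat.add_mul_div_right _ _ (by positivity), Nat.add_mul_mod_self_right]
    · rw [add_comm, Nat.add_mul_div_right _ _ (by positivity),
        Nat.div_eq_of_lt (packColours_lt f v), zero_add, Nat.mod_mod]

/-- One round of colour refinement. -/
def refineColours (S : List (List ℕ)) (k n C : ℕ) : ℕ :=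
  packColours (fun v => colour C v +
    listSum (nbrCodes S k v) fun u => withValue (colour C u) fun c => c * c * c + 5 * c) n

/-- Several rounds of colour refinement. -/
def iterateRefine (S : List (List ℕ)) (k n : ℕ) : ℕ → ℕ → ℕ
  | 0, C => C
  | r + 1, C => withValue (refineColours S k n C) fun C' => iterateRefine S k n r C'

/-- The colouring by the number of closed walks of length three. -/
def triangleColours (S : List (List ℕ)) (k n : ℕ) : ℕ :=
  packColours (fun v => listSum (nbrCodes S k v) fun u => listSum (nbrCodes S k u) fun w =>
    listSum (nbrCodes S k w) fun x => if x = v then 1 else 0) n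

/-- Check that `S` lists the neighbours of the vertices `(0, i)` in a `d`-regular
translation-invariant graph on `ZMod k × Fin m`. -/
def isNbrTable (k m d : ℕ) (S : List (List ℕ)) : Bool :=
  (List.range m).all fun i =>
    decide (S.getD i []).Nodup && (S.getD i []).length == d && !(S.getD i []).contains (i * k) &&
    (S.getD i []).all fun c =>
      decide (c < m * k) && (S.getD (c / k) []).contains (i * k + (k - c % k) % k)

/-- Check by colour refinement that all automorphisms are translations. -/
def isRigidTable (k m r : ℕ) (S : List (List ℕ)) : Bool :=
  withValue (triangleColours S k (m * k)) fun T =>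
  withValue (iterateRefine S k (m * k) r T) fun C =>
    ((List.range (m * k)).all fun v => decide (v < k) || colour C v != colour C 0) &&
    withValue (packColours (fun v => 2 * colour C v + if v = 0 then 1 else 0) (m * k)) fun I =>
    withValue (iterateRefine S k (m * k) r I) fun D =>
      (List.range (m * k)).all fun v => (List.range v).all fun u => colour D u != colour D v

/-- The adjacency relation described by a table of neighbours. -/
def tableRel (k m : ℕ) (S : List (List ℕ)) (i j : Fin m) (t : ZMod k) : Prop :=
  (j : ℕ) * k + t.val ∈ S.getD i []

/-- The code of a vertex. -/
def vertexCode {k m : ℕ} (v : ZMod k × Fin m) : ℕ := v.2 * k + v.1.val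

section Table

variable {k m d : ℕ} [NeZero k] {S : List (List ℕ)}

theorem vertexCode_div (v : ZMod k × Fin m) : vertexCode v / k = v.2 := by
  have := ZMod.val_lt v.1
  rw [vertexCode, add_comm, Nat.add_mul_div_right _ _ (NeZero.pos k), Nat.div_eq_of_lt this,
    zero_add]

theorem vertexCode_mod (v : ZMod k × Fin m) : vertexCode v % k = v.1.val := by
  rw [vertexCode, add_comm, Nat.add_mul_mod_self_right, Nat.mod_eq_of_lt (ZMod.val_lt v.1)]

theorem vertexCode_lt (v : ZMod k × Fin m) : vertexCode v < m * k := by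
  have h1 := ZMod.val_lt v.1
  have h2 : ((v.2 : ℕ) + 1) * k ≤ m * k := Nat.mul_le_mul_right k v.2.isLt
  rw [vertexCode]
  linarith

theorem vertexCode_injective : Function.Injective (vertexCode (k := k) (m := m)) := by
  intro u v h
  have h1 := vertexCode_div u
  have h2 := vertexCode_mod u
  rw [h, vertexCode_div] at h1
  rw [h, vertexCode_mod] at h2
  exact Prod.ext (ZMod.val_injective k h2.symm) (Fin.ext h1.symm)

omit [NeZero k] in
theorem isNbrTable.spec (hS : isNbrTable k m d S = true) {i : ℕ} (hi : i < m) :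
    (S.getD i []).Nodup ∧ (S.getD i []).length = d ∧ i * k ∉ S.getD i [] ∧
    ∀ c ∈ S.getD i [], c < m * k ∧ i * k + (k - c % k) % k ∈ S.getD (c / k) [] := by
  have := List.all_eq_true.mp hS i (List.mem_range.mpr hi)
  simp only [Bool.and_eq_true, decide_eq_true_eq, beq_iff_eq, Bool.not_eq_true',
    List.all_eq_true, List.contains_iff_mem] at this
  obtain ⟨⟨⟨h1, h2⟩, h3⟩, h4⟩ := this
  exact ⟨h1, h2, by simpa using h3, h4⟩

theorem tableRel_symm (hS : isNbrTable k m d S = true) (i j : Fin m) (t : ZMod k)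
    (h : tableRel k m S i j t) : tableRel k m S j i (-t) := by
  have h1 := ((isNbrTable.spec hS i.isLt).2.2.2 _ h).2
  have h2 := vertexCode_div (m := m) (t, j)
  have h3 := vertexCode_mod (m := m) (t, j)
  simp only [vertexCode] at h2 h3
  rw [h2, h3] at h1
  rwa [tableRel, ZMod.neg_val']

omit [NeZero k] in
theorem tableRel_irrefl (hS : isNbrTable k m d S = true) (i : Fin m) :
    ¬ tableRel k m S i i 0 := by
  simpa [tableRel] using (isNbrTable.spec hS i.isLt).2.2.1

/-- The graph described by a table of neighbours. -/
def tableGraph (hS : isNbrTable k m d S = true) : SimpleGraph (ZMod k × Fin m) :=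
  liftGraph (tableRel k m S) (tableRel_symm hS) (tableRel_irrefl hS)

open Classical in
theorem listSum_nbrCodes (hS : isNbrTable k m d S = true) (v : ZMod k × Fin m) (g : ℕ → ℕ) :
    listSum (nbrCodes S k (vertexCode v)) g =
      ∑ u with (tableGraph hS).Adj v u, g (vertexCode u) := by
  obtain ⟨h1, -, -, h4⟩ := isNbrTable.spec hS v.2.isLt
  have hlt : ∀ c ∈ S.getD v.2 [], c / k < m := fun c hc =>
    Nat.div_lt_of_lt_mul (by rw [mul_comm]; exact (h4 c hc).1)
  have hcode : ∀ (t : ZMod k) (j : Fin m), ((j : ℕ) * k + t.val) / k = j := fun t j =>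
    vertexCode_div (m := m) (t, j)
  rw [listSum_eq, nbrCodes, vertexCode_div, vertexCode_mod, List.map_map,
    ← List.sum_toFinset _ h1]
  refine Finset.sum_bij'
    (fun c hc => (v.1 + (c : ZMod k), ⟨c / k, hlt c (List.mem_toFinset.mp hc)⟩))
    (fun u _ => u.2 * k + (u.1 - v.1).val) ?_ ?_ ?_ ?_ ?_
  · intro c hc
    refine Finset.mem_filter.mpr ⟨Finset.mem_univ _, ?_⟩
    change c / k * k + (v.1 + (c : ZMod k) - v.1).val ∈ S.getD v.2 []
    rw [add_sub_cancel_left, ZMod.val_natCast, Nat.div_add_mod']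
    exact List.mem_toFinset.mp hc
  · intro u hu
    exact List.mem_toFinset.mpr (Finset.mem_filter.mp hu).2
  · intro c hc
    simp only [add_sub_cancel_left, ZMod.val_natCast, Nat.div_add_mod']
  · intro u hu
    refine Prod.ext ?_ (Fin.ext (hcode _ _))
    simp
  · intro c hc
    simp only [Function.comp_apply, vertexCode, ZMod.val_add, ZMod.val_natCast]
    rw [add_comm (c % k)]

theorem ncard_neighborSet_tableGraph (hS : isNbrTable k m d S = true) (v : ZMod k × Fin m) :
    ((tableGraph hS).neighborSet v).ncard = d := by
  classical
  have h := listSum_nbrCodes hS v fun _ => 1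
  rw [listSum_eq, nbrCodes, vertexCode_div] at h
  simp only [List.map_const', List.sum_replicate, List.length_map, smul_eq_mul, mul_one,
    Finset.sum_const, (isNbrTable.spec hS v.2.isLt).2.1] at h
  refine Eq.trans ?_ h.symm
  rw [← Set.ncard_coe_finset]
  congr 1
  ext u
  simp

theorem listSum_nbrCodes_aut (hS : isNbrTable k m d S = true) {σ : Equiv.Perm (ZMod k × Fin m)}
    (hσ : IsGraphAut (tableGraph hS) σ) {f g : ℕ → ℕ}
    (hfg : ∀ u, f (vertexCode (σ u)) = g (vertexCode u)) (v : ZMod k × Fin m) :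
    listSum (nbrCodes S k (vertexCode (σ v))) f = listSum (nbrCodes S k (vertexCode v)) g := by
  classical
  rw [listSum_nbrCodes hS, listSum_nbrCodes hS]
  symm
  refine Finset.sum_equiv σ (fun u => ?_) fun u _ => (hfg u).symm
  simpa using (hσ v u).symm

theorem colour_refineColours_aut (hS : isNbrTable k m d S = true)
    {σ : Equiv.Perm (ZMod k × Fin m)} (hσ : IsGraphAut (tableGraph hS) σ) {C : ℕ}
    (hC : ∀ v, colour C (vertexCode (σ v)) = colour C (vertexCode v)) (v : ZMod k × Fin m) :
    colour (refineColours S k (m * k) C) (vertexCode (σ v)) =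
      colour (refineColours S k (m * k) C) (vertexCode v) := by
  rw [refineColours, colour_packColours _ (vertexCode_lt _),
    colour_packColours _ (vertexCode_lt _), hC]
  congr 2
  exact listSum_nbrCodes_aut hS hσ (fun u => by rw [hC]) v

theorem colour_iterateRefine_aut (hS : isNbrTable k m d S = true)
    {σ : Equiv.Perm (ZMod k × Fin m)} (hσ : IsGraphAut (tableGraph hS) σ) (r : ℕ) {C : ℕ}
    (hC : ∀ v, colour C (vertexCode (σ v)) = colour C (vertexCode v)) (v : ZMod k × Fin m) :
    colour (iterateRefine S k (m * k) r C) (vertexCode (σ v)) =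
      colour (iterateRefine S k (m * k) r C) (vertexCode v) := by
  induction r generalizing C with
  | zero => exact hC v
  | succ r ih =>
    rw [iterateRefine, withValue_eq]
    exact ih (colour_refineColours_aut hS hσ hC)

theorem colour_triangleColours_aut (hS : isNbrTable k m d S = true)
    {σ : Equiv.Perm (ZMod k × Fin m)} (hσ : IsGraphAut (tableGraph hS) σ) (v : ZMod k × Fin m) :
    colour (triangleColours S k (m * k)) (vertexCode (σ v)) =
      colour (triangleColours S k (m * k)) (vertexCode v) := by
  rw [triangleColours, colour_packColours _ (vertexCode_lt _),
    colour_packColours _ (vertexCode_lt _)]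
  congr 1
  refine listSum_nbrCodes_aut hS hσ (fun u => ?_) v
  refine listSum_nbrCodes_aut hS hσ (fun w => ?_) u
  refine listSum_nbrCodes_aut hS hσ (fun x => ?_) w
  simp [vertexCode_injective.eq_iff]

theorem hasMGRR_of_isRigidTable (hm : 1 ≤ m) (hS : isNbrTable k m d S = true) {r : ℕ}
    (hr : isRigidTable k m r S = true) : HasMGRR (Multiplicative (ZMod k)) m := by
  refine hasMGRR_of_liftGraph hm d (ncard_neighborSet_tableGraph hS) fun σ hσ => ?_
  set C := iterateRefine S k (m * k) r (triangleColours S k (m * k)) with hC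
  simp only [isRigidTable, withValue_eq, Bool.and_eq_true, List.all_eq_true, List.mem_range,
    Bool.or_eq_true, decide_eq_true_eq, bne_iff_ne, ← hC] at hr
  obtain ⟨h1, h2⟩ := hr
  set v₀ : ZMod k × Fin m := (0, ⟨0, hm⟩) with hv₀
  have hcode : vertexCode v₀ = 0 := by simp [vertexCode, hv₀]
  have hCσ : ∀ {τ}, IsGraphAut (tableGraph hS) τ → ∀ v,
      colour C (vertexCode (τ v)) = colour C (vertexCode v) := fun hτ =>
    colour_iterateRefine_aut hS hτ r (colour_triangleColours_aut hS hτ)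
  have hfib : (σ v₀).2 = v₀.2 := by
    have h := (h1 _ (vertexCode_lt (σ v₀))).resolve_right
      (not_not.mpr (by rw [hCσ hσ, hcode]))
    have := vertexCode_div (σ v₀)
    rw [Nat.div_eq_of_lt h] at this
    exact Fin.ext this.symm
  set τ := translation k m (Multiplicative.ofAdd (-(σ v₀).1)) * σ with hτ
  have hτaut : IsGraphAut (tableGraph hS) τ := (isGraphAut_translation _).mul hσ
  have hτ₀ : τ v₀ = v₀ := by
    rw [hτ, Equiv.Perm.mul_apply, translation_apply]
    exact Prod.ext (by simp [hv₀]) hfib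
  have hτfix : ∀ v, τ v = v := by
    intro v
    have hI := colour_iterateRefine_aut hS hτaut r
      (C := packColours (fun v => 2 * colour C v + if v = 0 then 1 else 0) (m * k)) (fun v => by
        rw [colour_packColours _ (vertexCode_lt _), colour_packColours _ (vertexCode_lt _),
          hCσ hτaut]
        have : vertexCode (τ v) = 0 ↔ vertexCode v = 0 := by
          rw [← hcode, vertexCode_injective.eq_iff, vertexCode_injective.eq_iff]
          nth_rewrite 1 [← hτ₀]
          exact τ.injective.eq_iff
        simp only [this]) v
    apply vertexCode_injective
    rcases lt_trichotomy (vertexCode (τ v)) (vertexCode v) with h | h | h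
    · exact absurd hI (h2 _ (vertexCode_lt _) _ h)
    · exact h
    · exact absurd hI.symm (h2 _ (vertexCode_lt _) _ h)
  refine ⟨(σ v₀).1, fun v => ?_⟩
  have := hτfix v
  rw [hτ, Equiv.Perm.mul_apply, translation_apply] at this
  conv_rhs => rw [← this]
  simp

end Table

/-- The edges `i < j` of a 4-regular asymmetric graph on `m` vertices, apart from the edge joining
`6` to `m - 1`: the square of the cycle `0, 1, …, m - 2`, in which the edges joining `0` to `1` and
`4` to `6` are replaced by edges to the additional vertex `m - 1`. -/
def chainEdge (m i j : ℕ) : Prop :=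
  (j = i + 1 ∧ j + 2 ≤ m ∧ i ≠ 0) ∨ (j = i + 2 ∧ j + 2 ≤ m ∧ i ≠ 4) ∨
  (i = 0 ∧ j + 3 = m) ∨ (i ≤ 1 ∧ j + 2 = m) ∨ ((i ≤ 1 ∨ i = 4) ∧ j + 1 = m)

/-- Adjacency in the base graph. -/
def baseAdj (m i j : ℕ) : Prop :=
  chainEdge m i j ∨ chainEdge m j i ∨ (i = 6 ∧ j + 1 = m) ∨ (j = 6 ∧ i + 1 = m)

/-- The base graph with voltage `1` on the edge from `6` to `m - 1` and `0` elsewhere. -/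
def chainRel (k m : ℕ) (i j : Fin m) (t : ZMod k) : Prop :=
  ((chainEdge m i j ∨ chainEdge m j i) ∧ t = 0) ∨ ((i : ℕ) = 6 ∧ (j : ℕ) + 1 = m ∧ t = 1) ∨
  ((j : ℕ) = 6 ∧ (i : ℕ) + 1 = m ∧ t = -1)


theorem baseAdj_zero_iff {m j : ℕ} (hm : 11 ≤ m) :
    baseAdj m 0 j ↔ j = 2 ∨ j = m - 3 ∨ j = m - 2 ∨ j = m - 1 := by
  unfold baseAdj chainEdge
  constructor
  · rintro ((h | h | h | h | h) | (h | h | h | h | h) | h | h) <;> omega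
  · rintro (h | h | h | h) <;> grind

theorem baseAdj_one_iff {m j : ℕ} (hm : 11 ≤ m) :
    baseAdj m 1 j ↔ j = 2 ∨ j = 3 ∨ j = m - 2 ∨ j = m - 1 := by
  unfold baseAdj chainEdge
  constructor
  · rintro ((h | h | h | h | h) | (h | h | h | h | h) | h | h) <;> omega
  · rintro (h | h | h | h) <;> grind

theorem baseAdj_two_iff {m j : ℕ} (hm : 11 ≤ m) :
    baseAdj m 2 j ↔ j = 0 ∨ j = 1 ∨ j = 3 ∨ j = 4 := by
  unfold baseAdj chainEdge
  constructor
  · rintro ((h | h | h | h | h) | (h | h | h | h | h) | h | h) <;> omega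
  · rintro (h | h | h | h) <;> grind

theorem baseAdj_three_iff {m j : ℕ} (hm : 11 ≤ m) :
    baseAdj m 3 j ↔ j = 1 ∨ j = 2 ∨ j = 4 ∨ j = 5 := by
  unfold baseAdj chainEdge
  constructor
  · rintro ((h | h | h | h | h) | (h | h | h | h | h) | h | h) <;> omega
  · rintro (h | h | h | h) <;> grind

theorem baseAdj_four_iff {m j : ℕ} (hm : 11 ≤ m) :
    baseAdj m 4 j ↔ j = 2 ∨ j = 3 ∨ j = 5 ∨ j = m - 1 := by
  unfold baseAdj chainEdge
  constructor
  · rintro ((h | h | h | h | h) | (h | h | h | h | h) | h | h) <;> omega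
  · rintro (h | h | h | h) <;> grind

theorem baseAdj_five_iff {m j : ℕ} (hm : 11 ≤ m) :
    baseAdj m 5 j ↔ j = 3 ∨ j = 4 ∨ j = 6 ∨ j = 7 := by
  unfold baseAdj chainEdge
  constructor
  · rintro ((h | h | h | h | h) | (h | h | h | h | h) | h | h) <;> omega
  · rintro (h | h | h | h) <;> grind

theorem baseAdj_six_iff {m j : ℕ} (hm : 11 ≤ m) :
    baseAdj m 6 j ↔ j = 5 ∨ j = 7 ∨ j = 8 ∨ j = m - 1 := by
  unfold baseAdj chainEdge
  constructor
  · rintro ((h | h | h | h | h) | (h | h | h | h | h) | h | h) <;> omega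
  · rintro (h | h | h | h) <;> grind

theorem baseAdj_mid_iff {m i j : ℕ} (hi : 7 ≤ i) (him : i + 4 ≤ m) :
    baseAdj m i j ↔ j = i - 2 ∨ j = i - 1 ∨ j = i + 1 ∨ j = i + 2 := by
  unfold baseAdj chainEdge
  constructor
  · rintro ((h | h | h | h | h) | (h | h | h | h | h) | h | h) <;> omega
  · rintro (h | h | h | h) <;> grind

theorem baseAdj_sub_three_iff {m j : ℕ} (hm : 11 ≤ m) :
    baseAdj m (m - 3) j ↔ j = 0 ∨ j = m - 5 ∨ j = m - 4 ∨ j = m - 2 := by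
  unfold baseAdj chainEdge
  constructor
  · rintro ((h | h | h | h | h) | (h | h | h | h | h) | h | h) <;> omega
  · rintro (h | h | h | h) <;> grind

theorem baseAdj_sub_two_iff {m j : ℕ} (hm : 11 ≤ m) :
    baseAdj m (m - 2) j ↔ j = 0 ∨ j = 1 ∨ j = m - 4 ∨ j = m - 3 := by
  unfold baseAdj chainEdge
  constructor
  · rintro ((h | h | h | h | h) | (h | h | h | h | h) | h | h) <;> omega
  · rintro (h | h | h | h) <;> grind

theorem baseAdj_sub_one_iff {m j : ℕ} (hm : 11 ≤ m) :
    baseAdj m (m - 1) j ↔ j = 0 ∨ j = 1 ∨ j = 4 ∨ j = 6 := by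
  unfold baseAdj chainEdge
  constructor
  · rintro ((h | h | h | h | h) | (h | h | h | h | h) | h | h) <;> omega
  · rintro (h | h | h | h) <;> grind

theorem baseAdj_comm {m i j : ℕ} : baseAdj m i j ↔ baseAdj m j i := by
  unfold baseAdj
  tauto

theorem exists_baseAdj_iff {m i : ℕ} (hm : 11 ≤ m) (hi : i < m) :
    ∃ p q r s : ℕ, p < m ∧ q < m ∧ r < m ∧ s < m ∧ [p, q, r, s].Nodup ∧
      ∀ j, baseAdj m i j ↔ j = p ∨ j = q ∨ j = r ∨ j = s := by
  have hnodup : ∀ p q r s : ℕ, p ≠ q ∧ p ≠ r ∧ p ≠ s ∧ q ≠ r ∧ q ≠ s ∧ r ≠ s →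
      [p, q, r, s].Nodup := fun p q r s h => by
    simp
    tauto
  by_cases h : 7 ≤ i ∧ i + 4 ≤ m
  · exact ⟨_, _, _, _, by omega, by omega, by omega, by omega, hnodup _ _ _ _ (by omega),
      fun j => baseAdj_mid_iff h.1 h.2⟩
  rcases (by omega : i = 0 ∨ i = 1 ∨ i = 2 ∨ i = 3 ∨ i = 4 ∨ i = 5 ∨ i = 6 ∨ i = m - 3 ∨
    i = m - 2 ∨ i = m - 1) with rfl | rfl | rfl | rfl | rfl | rfl | rfl | rfl | rfl | rfl
  · exact ⟨_, _, _, _, by omega, by omega, by omega, by omega, hnodup _ _ _ _ (by omega),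
      fun j => baseAdj_zero_iff hm⟩
  · exact ⟨_, _, _, _, by omega, by omega, by omega, by omega, hnodup _ _ _ _ (by omega),
      fun j => baseAdj_one_iff hm⟩
  · exact ⟨_, _, _, _, by omega, by omega, by omega, by omega, hnodup _ _ _ _ (by omega),
      fun j => baseAdj_two_iff hm⟩
  · exact ⟨_, _, _, _, by omega, by omega, by omega, by omega, hnodup _ _ _ _ (by omega),
      fun j => baseAdj_three_iff hm⟩
  · exact ⟨_, _, _, _, by omega, by omega, by omega, by omega, hnodup _ _ _ _ (by omega),
      fun j => baseAdj_four_iff hm⟩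
  · exact ⟨_, _, _, _, by omega, by omega, by omega, by omega, hnodup _ _ _ _ (by omega),
      fun j => baseAdj_five_iff hm⟩
  · exact ⟨_, _, _, _, by omega, by omega, by omega, by omega, hnodup _ _ _ _ (by omega),
      fun j => baseAdj_six_iff hm⟩
  · exact ⟨_, _, _, _, by omega, by omega, by omega, by omega, hnodup _ _ _ _ (by omega),
      fun j => baseAdj_sub_three_iff hm⟩
  · exact ⟨_, _, _, _, by omega, by omega, by omega, by omega, hnodup _ _ _ _ (by omega),
      fun j => baseAdj_sub_two_iff hm⟩
  · exact ⟨_, _, _, _, by omega, by omega, by omega, by omega, hnodup _ _ _ _ (by omega),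
      fun j => baseAdj_sub_one_iff hm⟩

theorem chainRel_symm {k m : ℕ} (i j : Fin m) (t : ZMod k) (h : chainRel k m i j t) :
    chainRel k m j i (-t) := by
  unfold chainRel at *
  rcases h with ⟨h, rfl⟩ | ⟨h1, h2, rfl⟩ | ⟨h1, h2, rfl⟩
  · exact Or.inl ⟨h.symm, neg_zero⟩
  · exact Or.inr (Or.inr ⟨h1, h2, rfl⟩)
  · exact Or.inr (Or.inl ⟨h1, h2, neg_neg 1⟩)

theorem chainRel_irrefl {k m : ℕ} (hm : 11 ≤ m) (i : Fin m) : ¬ chainRel k m i i 0 := by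
  unfold chainRel chainEdge
  omega

/-- The lift of the base graph to `ZMod k × Fin m`. -/
def chainGraph (k : ℕ) {m : ℕ} (hm : 11 ≤ m) : SimpleGraph (ZMod k × Fin m) :=
  liftGraph (chainRel k m) chainRel_symm (chainRel_irrefl hm)

section Chain

variable {k m : ℕ} {hm : 11 ≤ m}

theorem chainGraph_adj_iff {u v : ZMod k × Fin m} :
    (chainGraph k hm).Adj u v ↔ chainRel k m u.2 v.2 (v.1 - u.1) := Iff.rfl

theorem baseAdj_of_adj {u v : ZMod k × Fin m} (h : (chainGraph k hm).Adj u v) :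
    baseAdj m u.2 v.2 := by
  rw [chainGraph_adj_iff] at h
  unfold chainRel at h
  unfold baseAdj
  tauto

theorem eq_of_adj_of_adj {u v w : ZMod k × Fin m} (hv : (chainGraph k hm).Adj u v)
    (hw : (chainGraph k hm).Adj u w) (h : (v.2 : ℕ) = w.2) : v = w := by
  rw [chainGraph_adj_iff] at hv hw
  refine Prod.ext ?_ (Fin.ext h)
  suffices v.1 - u.1 = w.1 - u.1 from sub_left_injective this
  unfold chainRel chainEdge at hv hw
  rw [← h] at hw
  rcases hv with ⟨hv, hv'⟩ | ⟨hv1, hv2, hv'⟩ | ⟨hv1, hv2, hv'⟩ <;>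
  rcases hw with ⟨hw, hw'⟩ | ⟨hw1, hw2, hw'⟩ | ⟨hw1, hw2, hw'⟩ <;>
  first
  | exact hv'.trans hw'.symm
  | (exfalso; omega)

theorem exists_adj_iff_baseAdj {v : ZMod k × Fin m} {j : ℕ} (hj : j < m) :
    (∃ u, (chainGraph k hm).Adj v u ∧ (u.2 : ℕ) = j) ↔ baseAdj m v.2 j := by
  constructor
  · rintro ⟨u, h, rfl⟩
    exact baseAdj_of_adj h
  · intro h
    have key : ∀ t : ZMod k, chainRel k m v.2 ⟨j, hj⟩ t →
        ∃ u, (chainGraph k hm).Adj v u ∧ (u.2 : ℕ) = j := fun t ht =>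
      ⟨(v.1 + t, ⟨j, hj⟩), by simpa [chainGraph_adj_iff] using ht, rfl⟩
    rcases h with h | h | h | h
    · exact key 0 (Or.inl ⟨Or.inl h, rfl⟩)
    · exact key 0 (Or.inl ⟨Or.inr h, rfl⟩)
    · exact key 1 (Or.inr (Or.inl ⟨h.1, h.2, rfl⟩))
    · exact key (-1) (Or.inr (Or.inr ⟨h.1, h.2, rfl⟩))

theorem ncard_neighborSet_chainGraph (v : ZMod k × Fin m) :
    ((chainGraph k hm).neighborSet v).ncard = 4 := by
  obtain ⟨p, q, r, s, hp, hq, hr, hs, hn, h⟩ := exists_baseAdj_iff hm v.2.isLt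
  have hinj : Set.InjOn (fun u : ZMod k × Fin m => (u.2 : ℕ)) ((chainGraph k hm).neighborSet v) :=
    fun u hu w hw huw => eq_of_adj_of_adj (hm := hm) hu hw huw
  have himg : (fun u : ZMod k × Fin m => (u.2 : ℕ)) '' ((chainGraph k hm).neighborSet v) =
      ([p, q, r, s].toFinset : Set ℕ) := by
    ext j
    simp only [Set.mem_image, SimpleGraph.mem_neighborSet, List.coe_toFinset, Set.mem_ofPred_eq,
      List.mem_cons, List.not_mem_nil, or_false]
    rw [← h]
    constructor
    · rintro ⟨u, hu, rfl⟩
      exact baseAdj_of_adj hu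
    · intro hj
      exact (exists_adj_iff_baseAdj (by have := (h j).mp hj; omega)).mpr hj
  rw [← hinj.ncard_image, himg, Set.ncard_coe_finset, List.toFinset_card_of_nodup hn]
  rfl

/-- A predicate on vertices that is preserved by all automorphisms. -/
def AutInvariant {V : Type*} (Γ : SimpleGraph V) (P : V → Prop) : Prop :=
  ∀ σ, IsGraphAut Γ σ → ∀ v, P (σ v) ↔ P v

theorem autInvariant_of_imp {V : Type*} {Γ : SimpleGraph V} {P : V → Prop}
    (h : ∀ σ, IsGraphAut Γ σ → ∀ v, P v → P (σ v)) : AutInvariant Γ P := fun σ hσ v =>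
  ⟨fun hv => by simpa using h σ⁻¹ hσ.inv _ hv, h σ hσ v⟩

theorem AutInvariant.congr {V : Type*} {Γ : SimpleGraph V} {P Q : V → Prop}
    (hP : AutInvariant Γ P) (h : ∀ v, P v ↔ Q v) : AutInvariant Γ Q :=
  (funext fun v => propext (h v) : P = Q) ▸ hP

theorem AutInvariant.and {V : Type*} {Γ : SimpleGraph V} {P Q : V → Prop}
    (hP : AutInvariant Γ P) (hQ : AutInvariant Γ Q) : AutInvariant Γ fun v => P v ∧ Q v :=
  fun σ hσ v => and_congr (hP σ hσ v) (hQ σ hσ v)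

theorem AutInvariant.not {V : Type*} {Γ : SimpleGraph V} {P : V → Prop}
    (hP : AutInvariant Γ P) : AutInvariant Γ fun v => ¬ P v :=
  fun σ hσ v => not_congr (hP σ hσ v)

theorem AutInvariant.exists_adj {V : Type*} {Γ : SimpleGraph V} {P : V → Prop}
    (hP : AutInvariant Γ P) : AutInvariant Γ fun v => ∃ u, Γ.Adj v u ∧ P u :=
  autInvariant_of_imp fun σ hσ _ ⟨u, hu, hPu⟩ => ⟨σ u, (hσ _ _).mpr hu, (hP σ hσ u).mpr hPu⟩

theorem autInvariant_triangle {V : Type*} (Γ : SimpleGraph V) :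
    AutInvariant Γ fun v => ∃ u w, Γ.Adj v u ∧ Γ.Adj v w ∧ Γ.Adj u w :=
  autInvariant_of_imp fun σ hσ _ ⟨u, w, h1, h2, h3⟩ =>
    ⟨σ u, σ w, (hσ _ _).mpr h1, (hσ _ _).mpr h2, (hσ _ _).mpr h3⟩

theorem AutInvariant.exists_three_adj {V : Type*} {Γ : SimpleGraph V} {P : V → Prop}
    (hP : AutInvariant Γ P) : AutInvariant Γ fun v => ∃ u₁ u₂ u₃, u₁ ≠ u₂ ∧ u₁ ≠ u₃ ∧ u₂ ≠ u₃ ∧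
      (Γ.Adj v u₁ ∧ P u₁) ∧ (Γ.Adj v u₂ ∧ P u₂) ∧ (Γ.Adj v u₃ ∧ P u₃) :=
  autInvariant_of_imp fun σ hσ _ ⟨u₁, u₂, u₃, h12, h13, h23, h1, h2, h3⟩ =>
    ⟨σ u₁, σ u₂, σ u₃, σ.injective.ne h12, σ.injective.ne h13, σ.injective.ne h23,
      ⟨(hσ _ _).mpr h1.1, (hP σ hσ _).mpr h1.2⟩, ⟨(hσ _ _).mpr h2.1, (hP σ hσ _).mpr h2.2⟩,
      ⟨(hσ _ _).mpr h3.1, (hP σ hσ _).mpr h3.2⟩⟩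

variable (k hm) in
/-- The fibre over `i` is preserved by all automorphisms of the chain graph. -/
def FibreInvariant (i : ℕ) : Prop :=
  AutInvariant (chainGraph k hm) fun v => (v.2 : ℕ) = i

theorem FibreInvariant.adjInvariant {i : ℕ} (hi : FibreInvariant k hm i) (him : i < m) :
    AutInvariant (chainGraph k hm) fun v => baseAdj m i v.2 :=
  (AutInvariant.exists_adj hi).congr fun _ => (exists_adj_iff_baseAdj him).trans baseAdj_comm

theorem adj_of_chainEdge (a : ZMod k) {i j : Fin m} (h : chainEdge m i j) :
    (chainGraph k hm).Adj (a, i) (a, j) :=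
  chainGraph_adj_iff.mpr (Or.inl ⟨Or.inl h, sub_self a⟩)

theorem exists_chainEdge_triangle {i : ℕ} (hm : 11 ≤ m) (hi : i + 1 < m) :
    ∃ p q, p < m ∧ q < m ∧ chainEdge m p q ∧ (chainEdge m i p ∨ chainEdge m p i) ∧
      (chainEdge m i q ∨ chainEdge m q i) := by
  unfold chainEdge
  rcases (by omega : i = 0 ∨ i = 2 ∨ i = 1 ∨ i = 3 ∨ i = 4 ∨ (5 ≤ i ∧ i + 4 ≤ m) ∨ i = m - 3 ∨
    i = m - 2) with h | h | h | h | h | h | h | h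
  · exact ⟨m - 3, m - 2, by grind⟩
  · exact ⟨3, 4, by grind⟩
  · exact ⟨2, 3, by grind⟩
  · exact ⟨4, 5, by grind⟩
  · exact ⟨2, 3, by grind⟩
  · exact ⟨i + 1, i + 2, by grind⟩
  · exact ⟨m - 5, m - 4, by grind⟩
  · exact ⟨m - 4, m - 3, by grind⟩

theorem fibreInvariant_last : FibreInvariant k hm (m - 1) := by
  refine (autInvariant_triangle _).not.congr ?_
  rintro ⟨a, i, hi⟩
  change ¬ _ ↔ i = m - 1
  constructor
  · intro h
    by_contra hv
    obtain ⟨p, q, hp, hq, h1, h2, h3⟩ := exists_chainEdge_triangle (i := i) hm (by omega)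
    have key : ∀ j (hj : j < m), chainEdge m i j ∨ chainEdge m j i →
        (chainGraph k hm).Adj (a, ⟨i, hi⟩) (a, ⟨j, hj⟩) := fun j hj h =>
      h.elim (fun h => adj_of_chainEdge a h) fun h => (adj_of_chainEdge a h).symm
    exact h ⟨(a, ⟨p, hp⟩), (a, ⟨q, hq⟩), key p hp h2, key q hq h3, adj_of_chainEdge a h1⟩
  · rintro rfl ⟨u, w, h1, h2, h3⟩
    have h1 := (baseAdj_sub_one_iff hm).mp (baseAdj_of_adj h1)
    have h2 := (baseAdj_sub_one_iff hm).mp (baseAdj_of_adj h2)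
    have h3 := baseAdj_of_adj h3
    rcases h1 with h1 | h1 | h1 | h1 <;> rw [h1] at h3 <;>
    simp only [baseAdj_zero_iff hm, baseAdj_one_iff hm, baseAdj_four_iff hm,
      baseAdj_six_iff hm] at h3 <;>
    omega

theorem fibreInvariant_two : FibreInvariant k hm 2 := by
  have hlast : m - 1 < m := by omega
  refine ((AutInvariant.exists_three_adj (fibreInvariant_last.adjInvariant hlast)).and
    fibreInvariant_last.not).congr ?_
  rintro ⟨a, i, hi⟩
  change _ ∧ ¬ i = m - 1 ↔ i = 2
  constructor
  · rintro ⟨⟨u₁, u₂, u₃, h12, h13, h23, h1, h2, h3⟩, hv⟩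
    have h12' : (u₁.2 : ℕ) ≠ u₂.2 := fun h => h12 (eq_of_adj_of_adj h1.1 h2.1 h)
    have h13' : (u₁.2 : ℕ) ≠ u₃.2 := fun h => h13 (eq_of_adj_of_adj h1.1 h3.1 h)
    have h23' : (u₂.2 : ℕ) ≠ u₃.2 := fun h => h23 (eq_of_adj_of_adj h2.1 h3.1 h)
    have key : ∀ j, baseAdj m (m - 1) j → baseAdj m i j →
        (j = 0 ∧ (i = 2 ∨ m ≤ i + 3)) ∨ (j = 1 ∧ (i = 2 ∨ i = 3 ∨ m ≤ i + 2)) ∨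
        (j = 4 ∧ (i = 2 ∨ i = 3 ∨ i = 5)) ∨ (j = 6 ∧ (i = 5 ∨ i = 7 ∨ i = 8)) := by
      intro j hj hb
      rw [baseAdj_comm] at hb
      rcases (baseAdj_sub_one_iff hm).mp hj with rfl | rfl | rfl | rfl <;>
      simp only [baseAdj_zero_iff hm, baseAdj_one_iff hm, baseAdj_four_iff hm,
        baseAdj_six_iff hm] at hb <;>
      omega
    have g1 := key _ h1.2 (baseAdj_of_adj h1.1)
    have g2 := key _ h2.2 (baseAdj_of_adj h2.1)
    have g3 := key _ h3.2 (baseAdj_of_adj h3.1)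
    clear key h1 h2 h3
    omega
  · rintro rfl
    have key : ∀ j (hj : j < m), chainEdge m j 2 ∨ chainEdge m 2 j → (j = 0 ∨ j = 1 ∨ j = 4) →
        (chainGraph k hm).Adj (a, ⟨2, hi⟩) (a, ⟨j, hj⟩) ∧
          baseAdj m (m - 1) (⟨j, hj⟩ : Fin m) := by
      intro j hj h h'
      refine ⟨h.elim (fun h => (adj_of_chainEdge a h).symm) fun h => adj_of_chainEdge a h, ?_⟩
      rw [baseAdj_sub_one_iff hm]
      exact h'.imp_right fun h => h.imp_right Or.inl
    refine ⟨⟨(a, ⟨0, by omega⟩), (a, ⟨1, by omega⟩), (a, ⟨4, by omega⟩), by simp, by simp,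
      by simp, key 0 _ ?_ (by simp), key 1 _ ?_ (by simp), key 4 _ ?_ (by simp)⟩, by omega⟩ <;>
    · unfold chainEdge
      grind

theorem fibreInvariant_of_lt {i : ℕ} (hi : i < m) : FibreInvariant k hm i := by
  have hx := fibreInvariant_last (k := k) (hm := hm)
  have h2 := fibreInvariant_two (k := k) (hm := hm)
  have ax := hx.adjInvariant (by omega)
  simp only [baseAdj_sub_one_iff hm] at ax
  have a2 := h2.adjInvariant (by omega)
  simp only [baseAdj_two_iff hm] at a2
  have h6 : FibreInvariant k hm 6 := (ax.and a2.not).congr fun v => by omega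
  have h3 : FibreInvariant k hm 3 := (a2.and ax.not).congr fun v => by omega
  have a6 := h6.adjInvariant (by omega)
  simp only [baseAdj_six_iff hm] at a6
  have a3 := h3.adjInvariant (by omega)
  simp only [baseAdj_three_iff hm] at a3
  have h0 : FibreInvariant k hm 0 := (ax.and (a2.and a3.not)).congr fun v => by omega
  have h5 : FibreInvariant k hm 5 := (a3.and (ax.not.and h2.not)).congr fun v => by omega
  have a5 := h5.adjInvariant (by omega)
  simp only [baseAdj_five_iff hm] at a5
  have h4 : FibreInvariant k hm 4 := (ax.and (a5.and h6.not)).congr fun v => by omega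
  have h1 : FibreInvariant k hm 1 :=
    (ax.and (h0.not.and (h4.not.and h6.not))).congr fun v => by omega
  have h7 : FibreInvariant k hm 7 :=
    (a5.and (h3.not.and (h4.not.and h6.not))).congr fun v => by omega
  have h8 : FibreInvariant k hm 8 :=
    (a6.and (hx.not.and (h5.not.and h7.not))).congr fun v => by omega
  induction i using Nat.strong_induction_on with
  | _ i ih =>
    rcases (by omega : i = 0 ∨ i = 1 ∨ i = 2 ∨ i = 3 ∨ i = 4 ∨ i = 5 ∨ i = 6 ∨ i = 7 ∨ i = 8 ∨
      i = m - 1 ∨ (9 ≤ i ∧ i + 2 ≤ m)) with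
      rfl | rfl | rfl | rfl | rfl | rfl | rfl | rfl | rfl | rfl | h
    all_goals try assumption
    have i2 := (ih (i - 2) (by omega) (by omega)).adjInvariant (by omega)
    simp only [baseAdj_mid_iff (by omega : 7 ≤ i - 2) (by omega : i - 2 + 4 ≤ m)] at i2
    have i4 := ih (i - 4) (by omega) (by omega)
    have i3 := ih (i - 3) (by omega) (by omega)
    have i1 := ih (i - 1) (by omega) (by omega)
    exact (i2.and (i4.not.and (i3.not.and i1.not))).congr fun v => by omega

theorem chainGraph_rigid [NeZero k] {σ : Equiv.Perm (ZMod k × Fin m)}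
    (hσ : IsGraphAut (chainGraph k hm) σ) : ∃ g : ZMod k, ∀ v, σ v = (g + v.1, v.2) := by
  have hfib : ∀ v, (σ v).2 = v.2 := fun v =>
    Fin.ext ((fibreInvariant_of_lt v.2.isLt σ hσ v).mpr rfl)
  have hedge : ∀ (a : ZMod k) (i j : Fin m), chainEdge m i j → (σ (a, i)).1 = (σ (a, j)).1 := by
    intro a i j h
    have hadj := (hσ (a, i) (a, j)).mpr (adj_of_chainEdge (hm := hm) a h)
    rw [chainGraph_adj_iff, hfib, hfib] at hadj
    unfold chainRel at hadj
    unfold chainEdge at h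
    rcases hadj with ⟨-, h'⟩ | ⟨h1, h2, -⟩ | ⟨h1, h2, -⟩
    · exact (sub_eq_zero.mp h').symm
    · exfalso
      simp only at h1 h2
      omega
    · exfalso
      simp only at h1 h2
      omega
  set f : ZMod k → ZMod k := fun a => (σ (a, ⟨2, by omega⟩)).1 with hf
  have hmid : ∀ (a : ZMod k) (i : ℕ) (hi : 2 ≤ i) (him : i + 2 ≤ m),
      (σ (a, ⟨i, by omega⟩)).1 = f a := by
    intro a i hi
    induction i, hi using Nat.le_induction with
    | base => exact fun _ => rfl
    | succ i hi ih =>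
      intro him
      exact (hedge a ⟨i, by omega⟩ ⟨i + 1, by omega⟩
        (Or.inl ⟨rfl, him, by simp only; omega⟩)).symm.trans (ih (by omega))
  have hall : ∀ v, (σ v).1 = f v.1 := by
    rintro ⟨a, i, hi⟩
    have h0 : (σ (a, ⟨0, by omega⟩)).1 = f a := hedge a _ _ (by unfold chainEdge; simp; omega)
    rcases (by omega : i = 0 ∨ i = 1 ∨ (2 ≤ i ∧ i + 2 ≤ m) ∨ i = m - 1) with rfl | rfl | h | rfl
    · exact h0
    · exact hedge a _ _ (by unfold chainEdge; simp; omega)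
    · exact hmid a i h.1 h.2
    · rw [← h0]
      exact (hedge a _ _ (by unfold chainEdge; simp; omega)).symm
  have hstep : ∀ a, f (a + 1) = f a + 1 := by
    intro a
    have hadj : (chainGraph k hm).Adj (a, ⟨6, by omega⟩) (a + 1, ⟨m - 1, by omega⟩) := by
      rw [chainGraph_adj_iff]
      exact Or.inr (Or.inl ⟨rfl, by simp only; omega, by simp⟩)
    have h := (hσ _ _).mpr hadj
    rw [chainGraph_adj_iff, hfib, hfib, hall, hall] at h
    unfold chainRel chainEdge at h
    rcases h with ⟨h, -⟩ | ⟨-, -, h⟩ | ⟨h, -, -⟩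
    · exfalso
      simp only at h
      omega
    · exact sub_eq_iff_eq_add'.mp h
    · exfalso
      simp only at h
      omega
  have hnat : ∀ n : ℕ, f n = f 0 + n := by
    intro n
    induction n with
    | zero => simp
    | succ n ih => rw [Nat.cast_succ, hstep, ih, add_assoc]
  refine ⟨f 0, fun v => Prod.ext ?_ (hfib v)⟩
  rw [hall, ← ZMod.natCast_zmod_val v.1, hnat]

end Chain

theorem hasMGRR_of_eleven_le (k : ℕ) [NeZero k] {m : ℕ} (hm : 11 ≤ m) :
    HasMGRR (Multiplicative (ZMod k)) m :=
  hasMGRR_of_liftGraph (by omega) 4 (ncard_neighborSet_chainGraph (hm := hm)) fun _ hσ =>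
    chainGraph_rigid (hm := hm) hσ

theorem hasMGRR_zmod_one_one : HasMGRR (Multiplicative (ZMod 1)) 1 :=
  hasMGRR_of_isRigidTable (d := 0) (r := 1) (S := [[]])
      (by norm_num) (by decide +kernel) (by decide +kernel)

theorem hasMGRR_zmod_one {m : ℕ} (hm : 10 ≤ m) : HasMGRR (Multiplicative (ZMod 1)) m := by
  by_cases h : 11 ≤ m
  · exact hasMGRR_of_eleven_le _ h
  rw [not_le] at h
  interval_cases m
  · exact hasMGRR_of_isRigidTable (d := 4) (r := 1) (S := [[2, 5, 6, 9], [2, 3, 4, 7], [0, 1, 4, 9],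
      [1, 6, 7, 8], [1, 2, 5, 8], [0, 4, 6, 7], [0, 3, 5, 9], [1, 3, 5, 8], [3, 4, 7, 9], [0, 2,
      6, 8]])
      (by norm_num) (by decide +kernel) (by decide +kernel)

theorem hasMGRR_zmod_two_one : HasMGRR (Multiplicative (ZMod 2)) 1 :=
  hasMGRR_of_isRigidTable (d := 0) (r := 1) (S := [[]])
      (by norm_num) (by decide +kernel) (by decide +kernel)

theorem hasMGRR_zmod_two {m : ℕ} (hm : 5 ≤ m) : HasMGRR (Multiplicative (ZMod 2)) m := by
  by_cases h : 11 ≤ m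
  · exact hasMGRR_of_eleven_le _ h
  rw [not_le] at h
  interval_cases m
  · exact hasMGRR_of_isRigidTable (d := 4) (r := 1) (S := [[2, 4, 6, 8], [0, 3, 4, 6], [0, 2, 5, 9],
      [0, 2, 8, 9], [0, 5, 6, 7]])
      (by norm_num) (by decide +kernel) (by decide +kernel)
  · exact hasMGRR_of_isRigidTable (d := 5) (r := 1) (S := [[2, 4, 6, 8, 10], [0, 6, 8, 9, 11], [0, 6,
      9, 10, 11], [0, 2, 4, 9, 10], [0, 2, 3, 5, 7], [0, 3, 4, 5, 6]])
      (by norm_num) (by decide +kernel) (by decide +kernel)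
  · exact hasMGRR_of_isRigidTable (d := 6) (r := 1) (S := [[3, 4, 7, 9, 10, 12], [1, 3, 5, 6, 7, 11],
      [0, 3, 7, 8, 12, 13], [1, 2, 3, 5, 10, 11], [1, 4, 9, 10, 12, 13], [0, 3, 6, 7, 8, 11], [0,
      4, 5, 8, 9, 13]])
      (by norm_num) (by decide +kernel) (by decide +kernel)
  · exact hasMGRR_of_isRigidTable (d := 7) (r := 1) (S := [[3, 4, 7, 9, 10, 12, 15], [1, 3, 6, 8, 9,
      13, 15], [0, 6, 7, 9, 12, 14, 15], [1, 2, 4, 5, 7, 10, 13], [1, 2, 3, 5, 9, 10, 11], [0, 6,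
      8, 9, 12, 14, 15], [0, 3, 4, 7, 10, 13, 14], [1, 3, 4, 5, 10, 11, 12]])
      (by norm_num) (by decide +kernel) (by decide +kernel)
  · exact hasMGRR_of_isRigidTable (d := 3) (r := 2) (S := [[8, 11, 15], [3, 11, 16], [5, 9, 17], [9,
      12, 13], [0, 5, 7], [1, 3, 17], [6, 7, 15], [1, 13, 15], [2, 5, 11]])
      (by norm_num) (by decide +kernel) (by decide +kernel)
  · exact hasMGRR_of_isRigidTable (d := 4) (r := 2) (S := [[7, 11, 15, 19], [4, 9, 10, 12], [2, 10,
      17, 19], [1, 7, 9, 15], [3, 7, 9, 14], [1, 2, 4, 18], [2, 13, 14, 16], [1, 7, 8, 12], [5,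
      12, 17, 19], [1, 5, 10, 17]])
      (by norm_num) (by decide +kernel) (by decide +kernel)

theorem hasMGRR_zmod_three {m : ℕ} (hm : 4 ≤ m) : HasMGRR (Multiplicative (ZMod 3)) m := by
  by_cases h : 11 ≤ m
  · exact hasMGRR_of_eleven_le _ h
  rw [not_le] at h
  interval_cases m
  · exact hasMGRR_of_isRigidTable (d := 5) (r := 3) (S := [[1, 2, 5, 7, 10], [1, 4, 5, 6, 7], [2, 3,
      5, 9, 11], [2, 6, 7, 10, 11]])
      (by norm_num) (by decide +kernel) (by decide +kernel)
  · exact hasMGRR_of_isRigidTable (d := 4) (r := 3) (S := [[3, 4, 8, 12], [0, 2, 8, 13], [1, 4, 11,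
      14], [7, 10, 11, 12], [0, 5, 7, 9]])
      (by norm_num) (by decide +kernel) (by decide +kernel)
  · exact hasMGRR_of_isRigidTable (d := 4) (r := 3) (S := [[7, 10, 13, 16], [9, 12, 15, 17], [2, 11,
      12, 13], [2, 3, 7, 16], [2, 3, 6, 8], [2, 3, 4, 11]])
      (by norm_num) (by decide +kernel) (by decide +kernel)
  · exact hasMGRR_of_isRigidTable (d := 4) (r := 3) (S := [[11, 15, 16, 20], [4, 5, 11, 17], [9, 12,
      13, 20], [1, 4, 6, 19], [6, 8, 13, 14], [0, 2, 4, 18], [1, 7, 11, 15]])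
      (by norm_num) (by decide +kernel) (by decide +kernel)
  · exact hasMGRR_of_isRigidTable (d := 4) (r := 3) (S := [[6, 11, 12, 21], [4, 5, 18, 22], [0, 13,
      18, 21], [1, 14, 15, 16], [0, 8, 10, 18], [9, 11, 16, 17], [3, 6, 12, 22], [0, 5, 6, 20]])
      (by norm_num) (by decide +kernel) (by decide +kernel)
  · exact hasMGRR_of_isRigidTable (d := 4) (r := 3) (S := [[5, 10, 14, 19], [1, 6, 11, 20], [3, 7, 8,
      13], [2, 4, 15, 21], [1, 8, 15, 18], [9, 12, 23, 26], [2, 4, 12, 21], [9, 16, 18, 25], [16,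
      23, 25, 26]])
      (by norm_num) (by decide +kernel) (by decide +kernel)
  · exact hasMGRR_of_isRigidTable (d := 4) (r := 3) (S := [[7, 12, 19, 29], [4, 5, 18, 26], [2, 9, 22,
      25], [6, 13, 14, 15], [0, 10, 11, 28], [9, 20, 21, 22], [2, 3, 16, 28], [8, 15, 17, 25], [4,
      8, 23, 28], [1, 14, 20, 26]])
      (by norm_num) (by decide +kernel) (by decide +kernel)

theorem hasMGRR_zmod_four {m : ℕ} (hm : 3 ≤ m) : HasMGRR (Multiplicative (ZMod 4)) m := by
  by_cases h : 11 ≤ m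
  · exact hasMGRR_of_eleven_le _ h
  rw [not_le] at h
  interval_cases m
  · exact hasMGRR_of_isRigidTable (d := 4) (r := 3) (S := [[4, 7, 8, 10], [0, 1, 6, 9], [0, 2, 7,
      10]])
      (by norm_num) (by decide +kernel) (by decide +kernel)
  · exact hasMGRR_of_isRigidTable (d := 4) (r := 3) (S := [[6, 8, 10, 15], [2, 6, 12, 15], [0, 2, 10,
      14], [1, 4, 5, 10]])
      (by norm_num) (by decide +kernel) (by decide +kernel)
  · exact hasMGRR_of_isRigidTable (d := 4) (r := 3) (S := [[4, 8, 9, 16], [0, 9, 15, 18], [0, 3, 7,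
      14], [5, 10, 16, 17], [0, 6, 12, 15]])
      (by norm_num) (by decide +kernel) (by decide +kernel)
  · exact hasMGRR_of_isRigidTable (d := 4) (r := 3) (S := [[7, 11, 18, 23], [1, 6, 14, 20], [1, 16,
      19, 21], [6, 13, 15, 18], [2, 8, 9, 14], [1, 4, 11, 22]])
      (by norm_num) (by decide +kernel) (by decide +kernel)
  · exact hasMGRR_of_isRigidTable (d := 4) (r := 3) (S := [[13, 19, 22, 25], [6, 11, 12, 16], [5, 10,
      16, 23], [3, 4, 24, 27], [1, 4, 8, 21], [2, 9, 19, 24], [3, 12, 13, 20]])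
      (by norm_num) (by decide +kernel) (by decide +kernel)
  · exact hasMGRR_of_isRigidTable (d := 4) (r := 3) (S := [[2, 17, 21, 29], [17, 29, 30, 31], [13, 14,
      23, 24], [10, 11, 14, 18], [3, 7, 14, 23], [3, 9, 17, 25], [8, 23, 25, 27], [3, 5, 6, 7]])
      (by norm_num) (by decide +kernel) (by decide +kernel)
  · exact hasMGRR_of_isRigidTable (d := 4) (r := 3) (S := [[2, 12, 20, 30], [5, 7, 14, 19], [18, 19,
      26, 33], [0, 6, 25, 28], [5, 9, 10, 22], [0, 18, 24, 29], [10, 15, 20, 35], [2, 12, 23, 34],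
      [11, 25, 30, 34]])
      (by norm_num) (by decide +kernel) (by decide +kernel)
  · exact hasMGRR_of_isRigidTable (d := 4) (r := 3) (S := [[4, 12, 33, 38], [0, 6, 20, 39], [9, 11,
      21, 31], [0, 26, 31, 33], [18, 25, 26, 35], [4, 11, 26, 36], [14, 18, 19, 22], [9, 13, 32,
      36], [3, 15, 17, 28], [2, 5, 20, 28]])
      (by norm_num) (by decide +kernel) (by decide +kernel)

theorem hasMGRR_zmod_five {m : ℕ} (hm : 3 ≤ m) : HasMGRR (Multiplicative (ZMod 5)) m := by
  by_cases h : 11 ≤ m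
  · exact hasMGRR_of_eleven_le _ h
  rw [not_le] at h
  interval_cases m
  · exact hasMGRR_of_isRigidTable (d := 6) (r := 3) (S := [[6, 7, 9, 10, 13, 14], [1, 3, 4, 7, 8, 12],
      [0, 1, 2, 8, 12, 13]])
      (by norm_num) (by decide +kernel) (by decide +kernel)
  · exact hasMGRR_of_isRigidTable (d := 4) (r := 3) (S := [[5, 12, 17, 19], [0, 11, 12, 18], [3, 8, 9,
      19], [1, 3, 7, 11]])
      (by norm_num) (by decide +kernel) (by decide +kernel)
  · exact hasMGRR_of_isRigidTable (d := 4) (r := 3) (S := [[5, 13, 14, 18], [0, 15, 19, 20], [1, 2,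
      15, 20], [2, 5, 6, 10], [5, 10, 22, 23]])
      (by norm_num) (by decide +kernel) (by decide +kernel)
  · exact hasMGRR_of_isRigidTable (d := 4) (r := 3) (S := [[9, 13, 22, 24], [1, 13, 15, 26], [2, 7,
      15, 22], [5, 10, 25, 26], [1, 3, 13, 27], [9, 15, 19, 23]])
      (by norm_num) (by decide +kernel) (by decide +kernel)
  · exact hasMGRR_of_isRigidTable (d := 4) (r := 3) (S := [[11, 17, 22, 33], [13, 23, 27, 32], [4, 7,
      20, 26], [3, 17, 18, 23], [3, 7, 10, 17], [8, 14, 30, 34], [2, 8, 25, 26]])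
      (by norm_num) (by decide +kernel) (by decide +kernel)
  · exact hasMGRR_of_isRigidTable (d := 4) (r := 3) (S := [[10, 21, 32, 37], [6, 9, 17, 21], [0, 19,
      33, 39], [8, 11, 23, 36], [4, 9, 17, 26], [24, 27, 28, 33], [3, 12, 27, 35], [3, 11, 19,
      30]])
      (by norm_num) (by decide +kernel) (by decide +kernel)
  · exact hasMGRR_of_isRigidTable (d := 4) (r := 3) (S := [[11, 19, 32, 44], [19, 34, 35, 43], [4, 28,
      30, 40], [1, 6, 23, 40], [17, 22, 23, 25], [12, 20, 34, 35], [3, 6, 10, 26], [5, 25, 37,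
      38], [1, 7, 10, 15]])
      (by norm_num) (by decide +kernel) (by decide +kernel)
  · exact hasMGRR_of_isRigidTable (d := 4) (r := 3) (S := [[19, 23, 36, 45], [11, 20, 32, 44], [9, 25,
      34, 36], [1, 20, 28, 49], [2, 5, 15, 28], [10, 17, 22, 36], [8, 11, 40, 46], [4, 14, 29,
      40], [6, 30, 35, 45], [0, 16, 34, 40]])
      (by norm_num) (by decide +kernel) (by decide +kernel)

/-- The entry `(a, b)` of a relation packed into a number, 16 bits per row. -/
def entry (R a b : ℕ) : Bool :=
  Nat.beq (Nat.land 1 (Nat.shiftRight R (Nat.add (Nat.mul 16 a) b))) 1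

/-- Add the pairs `(i, j)` and `(j, i)` to a packed relation. -/
def addPair (R i j : ℕ) : ℕ :=
  Nat.lor (Nat.lor R (Nat.shiftLeft 1 (Nat.add (Nat.mul 16 i) j)))
    (Nat.shiftLeft 1 (Nat.add (Nat.mul 16 j) i))

/-- The number of entries in columns `b < j` of row `i`. -/
def rowCount (R i : ℕ) : ℕ → ℕ
  | 0 => 0
  | j + 1 => rowCount R i j + bif entry R i j then 1 else 0

/-- Whether columns `u` and `v` of a packed relation agree in rows `a < i`. -/
def sameColumns (R u v : ℕ) : ℕ → Bool
  | 0 => true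
  | i + 1 => (entry R i u == entry R i v) && sameColumns R u v i

/-- Check `P` on the `d`-regular graphs on `n` vertices whose adjacency matrix cannot be increased
lexicographically by exchanging consecutive vertices. The matrix `R` is known up to the entries in
columns `b < j` of row `i`, which number `c`. -/
def searchRegular (n d : ℕ) (P : ℕ → Bool) : ℕ → ℕ → ℕ → ℕ → ℕ → Bool
  | 0, _, _, _, _ => false
  | f + 1, R, i, j, c =>
    bif Nat.blt d c || Nat.blt (c + (n - j)) d then true
    else bif Nat.blt j n then
      withValue (j + 1) fun j' => searchRegular n d P f R i j' c &&
        (Nat.ble d c || (Nat.blt i (j - 1) && !entry R i (j - 1) && sameColumns R (j - 1) j i) ||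
          withValue (c + 1) fun c' => withValue (addPair R i j) fun R' =>
            searchRegular n d P f R' i j' c')
    else withValue (i + 1) fun i' =>
      bif Nat.beq i' n then P R
      else withValue (i + 2) fun j' => withValue (rowCount R i' i') fun c' =>
        searchRegular n d P f R i' j' c'

/-- The value at `a` of a partial map packed into a number, 4 bits per value. -/
def image (p a : ℕ) : ℕ := Nat.mod (Nat.shiftRight p (Nat.mul 4 a)) 16

/-- Check that `p` is an involutive automorphism of `R` that fixes a vertex and moves a vertex. -/
def isInvolution (n R p : ℕ) : Bool :=
  ((List.range n).all fun a => Nat.blt (image p a) n && Nat.beq (image p (image p a)) a &&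
    (List.range n).all fun b => entry R (image p a) (image p b) == entry R a b) &&
  ((List.range n).any fun a => Nat.beq (image p a) a) &&
  (List.range n).any fun a => !Nat.beq (image p a) a

/-- Search for an involutive automorphism of `R`; in the partial involution `p`, the value `15`
stands for an unknown image. -/
def findInvolution (n R : ℕ) : ℕ → ℕ → ℕ → Bool
  | 0, _, _ => false
  | f + 1, i, p =>
    bif Nat.beq i n then isInvolution n R p
    else withValue (i + 1) fun i' =>
      bif Nat.blt (image p i) 15 then findInvolution n R f i' p
      else (List.range' i' (n - i') ++ [i]).any fun x => Nat.beq (image p x) 15 &&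
        withValue (p - (15 - x) <<< (4 * i) - bif Nat.beq i x then 0 else (15 - i) <<< (4 * x))
          fun p' =>
        ((List.range n).all fun b => withValue (image p' b) fun y =>
          Nat.beq y 15 || entry R x y == entry R i b) &&
        findInvolution n R f i' p'

theorem entry_eq_testBit (R a b : ℕ) : entry R a b = R.testBit (16 * a + b) := by
  change Nat.beq (1 &&& R >>> (16 * a + b)) 1 = (1 &&& R >>> (16 * a + b) != 0)
  rw [Nat.one_and_eq_mod_two]
  rcases Nat.mod_two_eq_zero_or_one (R >>> (16 * a + b)) with h | h <;> rw [h] <;> rfl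

theorem entry_addPair {R i j a b : ℕ} (hi : i < 16) (hj : j < 16) (hb : b < 16) :
    entry (addPair R i j) a b =
      (entry R a b || decide (a = i ∧ b = j) || decide (a = j ∧ b = i)) := by
  have h : ∀ x y, x < 16 → y < 16 → Nat.testBit (1 <<< (16 * x + y)) (16 * a + b) =
      decide (a = x ∧ b = y) := by
    intro x y hx hy
    rw [Nat.one_shiftLeft, Nat.testBit_two_pow]
    exact decide_eq_decide.mpr (by omega)
  have h' : addPair R i j = R ||| 1 <<< (16 * i + j) ||| 1 <<< (16 * j + i) := rfl
  rw [entry_eq_testBit, entry_eq_testBit, h', Nat.testBit_or, Nat.testBit_or, h i j hi hj,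
    h j i hj hi]

theorem rowCount_eq (R i j : ℕ) : rowCount R i j = Nat.count (fun b => entry R i b = true) j := by
  induction j with
  | zero => rfl
  | succ j ih =>
    rw [rowCount, ih, Nat.count_succ]
    cases entry R i j <;> rfl

theorem sameColumns_iff {R u v i : ℕ} :
    sameColumns R u v i = true ↔ ∀ a < i, entry R a u = entry R a v := by
  induction i with
  | zero => simp [sameColumns]
  | succ i ih =>
    rw [Nat.forall_lt_succ_right, sameColumns, Bool.and_eq_true, ih, beq_iff_eq, and_comm]

theorem searchRegular_sound {n d : ℕ} {P : ℕ → Bool} {A : ℕ → ℕ → Bool} (hn : n ≤ 16)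
    (hsymm : ∀ a b, A a b = A b a) (hirr : ∀ a, A a a = false)
    (hdeg : ∀ a < n, Nat.count (fun b => A a b = true) n = d)
    (hswap : ∀ i j, i < j → j + 1 < n → (∀ a < i, A a j = A a (j + 1)) → A i j = false →
      A i (j + 1) = false) {f : ℕ} :
    ∀ {R i j c : ℕ}, i < n → i < j → j ≤ n →
      (∀ a < n, ∀ b < n, entry R a b =
        (A a b && decide (a < i ∨ b < i ∨ (a = i ∧ b < j) ∨ (b = i ∧ a < j)))) →
      c = Nat.count (fun b => A i b = true) j → searchRegular n d P f R i j c = true →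
      ∃ R', P R' = true ∧ ∀ a < n, ∀ b < n, entry R' a b = A a b := by
  induction f with
  | zero => simp [searchRegular]
  | succ f ih =>
    intro R i j c hi hij hj hR hc h
    have hle : c ≤ d := by
      rw [hc, ← hdeg i hi]
      exact Nat.count_monotone _ hj
    have hge : d ≤ c + (n - j) := by
      rw [hc, ← hdeg i hi]
      conv_lhs => rw [← Nat.add_sub_cancel' hj, Nat.count_add]
      exact Nat.add_le_add_left (Nat.count_le _) _
    have h1 : (Nat.blt d c || Nat.blt (c + (n - j)) d) = false := by
      simp [Nat.blt_eq, ← Bool.not_eq_true]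
      omega
    rw [searchRegular, h1, cond_false] at h
    rcases hj.lt_or_eq with hjn | rfl
    · have h2 : Nat.blt j n = true := by simpa using hjn
      simp only [h2, cond_true, withValue_eq, Bool.and_eq_true, Bool.or_eq_true] at h
      have hcount := Nat.count_succ (fun b => A i b = true) j
      rw [← hc] at hcount
      cases hA : A i j with
      | false =>
        refine ih hi (by omega) hjn (fun a ha b hb => ?_) (by simp [hcount, hA]) h.1
        rw [hR a ha b hb]
        have h3 : b = i → a = j → A a b = false := by rintro rfl rfl; rw [hsymm, hA]
        have h4 : a = i → b = j → A a b = false := by rintro rfl rfl; exact hA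
        grind
      | true =>
        rcases h.2 with (h2 | h2) | h2
        · exfalso
          have := Nat.count_monotone (fun b => A i b = true) (show j + 1 ≤ n from hjn)
          rw [Nat.ble_eq] at h2
          rw [hdeg i hi] at this
          simp [hA] at hcount
          omega
        · exfalso
          obtain ⟨⟨h5, h6⟩, h7⟩ := h2
          rw [sameColumns_iff] at h7
          have h5 : i < j - 1 := by simpa using h5
          have h8 := hswap i (j - 1) h5 (by omega) (fun a ha => ?_) ?_
          · rw [Nat.sub_add_cancel (by omega), hA] at h8
            exact absurd h8 (by simp)
          · have := h7 a ha
            rw [hR a (by omega) _ (by omega), hR a (by omega) _ (by omega)] at this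
            rw [Nat.sub_add_cancel (by omega)]
            simpa [ha] using this
          · rw [hR i hi _ (by omega)] at h6
            simpa [show j - 1 < j by omega] using h6
        · refine ih hi (by omega) hjn (fun a ha b hb => ?_) (by simp [hcount, hA]) h2
          rw [entry_addPair (by omega) (by omega) (by omega), hR a ha b hb]
          have h3 : b = i → a = j → A a b = true := by rintro rfl rfl; rw [hsymm, hA]
          have h4 : a = i → b = j → A a b = true := by rintro rfl rfl; exact hA
          grind
    · have h2 : Nat.blt j j = false := by simp [← Bool.not_eq_true]
      simp only [h2, cond_false, withValue_eq] at h
      rcases (Nat.succ_le_of_lt hi).lt_or_eq with hin | hin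
      · have h3 : Nat.beq (i + 1) j = false := by
          rw [← Bool.not_eq_true, Nat.beq_eq]
          exact hin.ne
        rw [h3, cond_false] at h
        refine ih hin (by omega) hin (fun a ha b hb => ?_) ?_ h
        · rw [hR a ha b hb]
          have h4 : a = i + 1 → b = i + 1 → A a b = false := by rintro rfl rfl; exact hirr _
          grind
        · rw [rowCount_eq, Nat.count_succ _ (i + 1), hirr, Nat.count_eq_card_filter_range,
            Nat.count_eq_card_filter_range]
          simp only [Bool.false_eq_true, if_false, add_zero]
          refine congrArg Finset.card (Finset.filter_congr fun b hb => ?_)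
          have hb := Finset.mem_range.mp hb
          rw [hR _ hin _ (by omega)]
          grind
      · have h3 : Nat.beq (i + 1) j = true := by
          rw [Nat.beq_eq]
          exact hin
        rw [h3, cond_true] at h
        refine ⟨R, h, fun a ha b hb => ?_⟩
        rw [hR a ha b hb]
        have h4 : a = i → b = i → A a b = false := by rintro rfl rfl; exact hirr _
        grind

theorem exists_isInvolution_of_findInvolution {n R f : ℕ} :
    ∀ {i p : ℕ}, findInvolution n R f i p = true → ∃ p', isInvolution n R p' = true := by
  induction f with
  | zero => simp [findInvolution]
  | succ f ih =>
    intro i p h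
    rw [findInvolution] at h
    cases h1 : Nat.beq i n with
    | true => exact ⟨p, by simpa [h1] using h⟩
    | false =>
      rw [h1, cond_false, withValue_eq] at h
      cases h2 : Nat.blt (image p i) 15 with
      | true =>
        rw [h2, cond_true] at h
        exact ih h
      | false =>
        simp only [h2, cond_false, List.any_eq_true, withValue_eq, Bool.and_eq_true] at h
        obtain ⟨x, -, -, -, h⟩ := h
        exact ih h

set_option maxHeartbeats 0 in
theorem searchRegular_findInvolution :
    ((List.range' 3 7).all fun n => (List.range ((n - 1) / 2 + 1)).all fun d =>
      searchRegular n d (fun R => findInvolution n R 20 0 (16 ^ n - 1)) 60 0 0 1 0) = true := by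
  decide +kernel

theorem exists_aut_of_isInvolution {V : Type*} {Γ : SimpleGraph V} {n R p : ℕ} (e : Fin n ≃ V)
    (hR : ∀ a b : Fin n, entry R a b = true ↔ Γ.Adj (e a) (e b)) (hp : isInvolution n R p = true) :
    ∃ σ, IsGraphAut Γ σ ∧ (∃ v, σ v = v) ∧ ∃ v, σ v ≠ v := by
  simp only [isInvolution, Bool.and_eq_true, List.all_eq_true, List.any_eq_true, List.mem_range,
    Nat.blt_eq, Nat.beq_eq, beq_iff_eq, Bool.not_eq_true', ← Bool.not_eq_true] at hp
  obtain ⟨⟨hp, u, hu, hu'⟩, v, hv, hv'⟩ := hp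
  let q : Fin n → Fin n := fun a => ⟨image p a, (hp a a.2).1.1⟩
  have hq : Function.Involutive q := fun a => Fin.ext (hp a a.2).1.2
  refine ⟨e.permCongr hq.toPerm, ?_, ⟨e ⟨u, hu⟩, ?_⟩, ⟨e ⟨v, hv⟩, ?_⟩⟩
  · intro x y
    obtain ⟨a, rfl⟩ := e.surjective x
    obtain ⟨b, rfl⟩ := e.surjective y
    simp only [Equiv.permCongr_apply, Equiv.symm_apply_apply, Function.Involutive.coe_toPerm]
    rw [← hR, ← hR, (hp a a.2).2 b b.2]
  · simpa [q, Fin.ext_iff] using hu'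
  · simpa [q, Fin.ext_iff] using hv'

theorem exists_equiv_lexMax {V : Type*} [Fintype V] (Γ : SimpleGraph V) {n : ℕ}
    (hn : Fintype.card V = n) : ∃ e : Fin n ≃ V, ∀ i j j' : Fin n, i < j → (j' : ℕ) = j + 1 →
      (∀ a < i, Γ.Adj (e a) (e j) ↔ Γ.Adj (e a) (e j')) → ¬ Γ.Adj (e i) (e j) →
      ¬ Γ.Adj (e i) (e j') := by
  classical
  let M : (Fin n ≃ V) → Lex (Fin n → Lex (Fin n → Bool)) := fun e =>
    toLex fun a => toLex fun b => decide (Γ.Adj (e a) (e b))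
  have : Nonempty (Fin n ≃ V) := ⟨(Fintype.equivFinOfCardEq hn).symm⟩
  obtain ⟨e, he⟩ := Finite.exists_max M
  refine ⟨e, fun i j j' hij hj' hcol h h' => ?_⟩
  have hij' : i < j' := by
    rw [Fin.lt_def] at *
    omega
  refine (he ((Equiv.swap j j').trans e)).not_gt ⟨i, fun a ha => ?_, j, fun b hb => ?_, ?_⟩
  · refine congrArg toLex (funext fun b => decide_eq_decide.mpr ?_)
    rw [Equiv.trans_apply, Equiv.trans_apply,
      Equiv.swap_apply_of_ne_of_ne (ha.trans hij).ne (ha.trans hij').ne]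
    rcases eq_or_ne b j with rfl | hbj
    · rw [Equiv.swap_apply_left]
      exact hcol a ha
    rcases eq_or_ne b j' with rfl | hbj'
    · rw [Equiv.swap_apply_right]
      exact (hcol a ha).symm
    rw [Equiv.swap_apply_of_ne_of_ne hbj hbj']
  · refine decide_eq_decide.mpr ?_
    have hbj' : b < j' := hb.trans (by rw [Fin.lt_def]; omega)
    rw [Equiv.trans_apply, Equiv.trans_apply, Equiv.swap_apply_of_ne_of_ne hij.ne hij'.ne,
      Equiv.swap_apply_of_ne_of_ne hb.ne hbj'.ne]
  · change decide _ < decide _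
    rw [Equiv.trans_apply, Equiv.trans_apply, Equiv.swap_apply_of_ne_of_ne hij.ne hij'.ne,
      Equiv.swap_apply_left, decide_eq_false h, decide_eq_true h']
    rfl

theorem exists_aut_of_le {V : Type*} [Fintype V] (Γ : SimpleGraph V) {n d : ℕ}
    (hn : Fintype.card V = n) (h3 : 3 ≤ n) (h9 : n ≤ 9) (hd : 2 * d < n)
    (hΓ : ∀ v, (Γ.neighborSet v).ncard = d) :
    ∃ σ, IsGraphAut Γ σ ∧ (∃ v, σ v = v) ∧ ∃ v, σ v ≠ v := by
  classical
  obtain ⟨e, he⟩ := exists_equiv_lexMax Γ hn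
  let A : ℕ → ℕ → Bool := fun a b =>
    if h : a < n ∧ b < n then decide (Γ.Adj (e ⟨a, h.1⟩) (e ⟨b, h.2⟩)) else false
  have hA : ∀ a b (ha : a < n) (hb : b < n), A a b = true ↔ Γ.Adj (e ⟨a, ha⟩) (e ⟨b, hb⟩) :=
    fun a b ha hb => by simp [A, ha, hb]
  have hcheck := searchRegular_findInvolution
  simp only [List.all_eq_true, List.mem_range'_1, List.mem_range] at hcheck
  suffices h : ∃ R, findInvolution n R 20 0 (16 ^ n - 1) = true ∧
      ∀ a < n, ∀ b < n, entry R a b = A a b by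
    obtain ⟨R, hR, hRA⟩ := h
    obtain ⟨p, hp⟩ := exists_isInvolution_of_findInvolution hR
    exact exists_aut_of_isInvolution e
      (fun a b => by rw [hRA a a.2 b b.2]; exact hA a b a.2 b.2) hp
  refine searchRegular_sound (A := A) (by omega) ?_ ?_ ?_ ?_ (by omega : 0 < n)
    one_pos (by omega) (fun a ha b hb => ?_) ?_ (hcheck n (by omega) d (by omega))
  · intro a b
    simp only [A, Γ.adj_comm, and_comm]
  · intro a
    simp [A]
  · intro a ha
    have h1 : Γ.neighborSet (e ⟨a, ha⟩) = e '' {b | Γ.Adj (e ⟨a, ha⟩) (e b)} := by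
      ext v
      simp
    have h2 : ((Finset.range n).filter fun b => A a b = true : Set ℕ) =
        Fin.val '' {b | Γ.Adj (e ⟨a, ha⟩) (e b)} := by
      ext b
      constructor
      · intro hb
        obtain ⟨hb, hab⟩ := Finset.mem_filter.mp (Finset.mem_coe.mp hb)
        have hb := Finset.mem_range.mp hb
        exact ⟨⟨b, hb⟩, (hA a b ha hb).mp hab, rfl⟩
      · rintro ⟨b, hb, rfl⟩
        exact Finset.mem_coe.mpr (Finset.mem_filter.mpr
          ⟨Finset.mem_range.mpr b.2, (hA a b ha b.2).mpr hb⟩)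
    rw [Nat.count_eq_card_filter_range, ← hΓ (e ⟨a, ha⟩), h1, ← Set.ncard_coe_finset, h2,
      e.injective.injOn.ncard_image, Fin.val_injective.injOn.ncard_image]
  · intro i j hij hj hcol h
    rw [← Bool.not_eq_true, hA i (j + 1) (by omega) hj]
    refine he ⟨i, by omega⟩ ⟨j, by omega⟩ ⟨j + 1, hj⟩ hij rfl (fun a ha => ?_) ?_
    · have := hcol a ha
      rw [Bool.eq_iff_iff, hA a j a.2 (by omega), hA a (j + 1) a.2 hj] at this
      exact this
    · rwa [← hA i j (by omega) (by omega), Bool.not_eq_true]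
  · have h1 : a = 0 → b = 0 → A a b = false := by
      rintro rfl rfl
      simp [A]
    have h2 : entry 0 a b = false := (entry_eq_testBit 0 a b).trans (Nat.zero_testBit _)
    grind
  · have h1 : A 0 0 = false := by simp [A]
    rw [← zero_add 1, Nat.count_succ, Nat.count_zero]
    simp [h1]

theorem exists_aut_of_regular {V : Type*} [Fintype V] (Γ : SimpleGraph V) {d : ℕ}
    (h3 : 3 ≤ Fintype.card V) (h9 : Fintype.card V ≤ 9)
    (hΓ : ∀ v, (Γ.neighborSet v).ncard = d) :
    ∃ σ, IsGraphAut Γ σ ∧ (∃ v, σ v = v) ∧ ∃ v, σ v ≠ v := by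
  classical
  by_cases hd : 2 * d < Fintype.card V
  · exact exists_aut_of_le Γ rfl h3 h9 hd hΓ
  obtain ⟨σ, hσ, h⟩ := exists_aut_of_le Γᶜ rfl h3 h9
    (d := Fintype.card V - d - 1) (by omega) fun v => by
      rw [SimpleGraph.neighborSet_compl, Set.ncard_sdiff_singleton_of_mem (by simp),
        Set.ncard_compl, hΓ, Nat.card_eq_fintype_card]
  refine ⟨σ, fun u v => ?_, h⟩
  rcases eq_or_ne u v with rfl | huv
  · simp
  · have := hσ u v
    simpa [SimpleGraph.compl_adj, huv, not_iff_not] using this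

theorem bijective_orbitMap {G V : Type*} [Group G] {ρ : G →* Equiv.Perm V} {m : ℕ}
    {reps : Fin m → V} (hsemi : ∀ (g : G) (v : V), ρ g v = v → g = 1)
    (hreps : ∀ v : V, ∃! i : Fin m, ∃ g : G, ρ g (reps i) = v) :
    Function.Bijective fun x : Fin m × G => ρ x.2 (reps x.1) := by
  constructor
  · rintro ⟨i, g⟩ ⟨j, h⟩ hgh
    simp only at hgh
    obtain rfl : i = j := (hreps (ρ h (reps j))).unique ⟨g, hgh⟩ ⟨h, rfl⟩
    have : ρ (h⁻¹ * g) (reps i) = reps i := by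
      rw [map_mul, Equiv.Perm.mul_apply, hgh, map_inv, Equiv.Perm.inv_def, Equiv.symm_apply_apply]
    rw [inv_mul_eq_one.mp (hsemi _ _ this)]
  · intro v
    obtain ⟨i, ⟨g, hg⟩, -⟩ := hreps v
    exact ⟨(i, g), hg⟩

theorem not_hasMGRR_of_card {G : Type*} [Group G] [Finite G] {m : ℕ} (h3 : 3 ≤ m * Nat.card G)
    (h9 : m * Nat.card G ≤ 9) : ¬ HasMGRR G m := by
  rintro ⟨V, _, Γ, ρ, ⟨d, hd⟩, -, hsurj, -, hsemi, reps, hreps⟩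
  have hcard : Fintype.card V = m * Nat.card G := by
    rw [← Nat.card_eq_fintype_card, ← Nat.card_eq_of_bijective _ (bijective_orbitMap hsemi hreps),
      Nat.card_prod, Nat.card_fin]
  obtain ⟨σ, hσ, ⟨v, hv⟩, w, hw⟩ := exists_aut_of_regular Γ (hcard ▸ h3) (hcard ▸ h9) hd
  obtain ⟨g, rfl⟩ := hsurj σ hσ
  rw [hsemi g v hv] at hw
  exact hw (by simp)

theorem not_hasMGRR_two_of_subsingleton {G : Type*} [Group G] [Subsingleton G] :
    ¬ HasMGRR G 2 := by
  classical
  rintro ⟨V, _, Γ, ρ, -, -, hsurj, -, hsemi, reps, hreps⟩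
  obtain ⟨hinj, hsur⟩ := bijective_orbitMap hsemi hreps
  have hne : reps 0 ≠ reps 1 := fun h => by
    have := @hinj (0, 1) (1, 1) (by simpa using h)
    simp at this
  have hcases : ∀ v, v = reps 0 ∨ v = reps 1 := fun v => by
    obtain ⟨⟨i, g⟩, rfl⟩ := hsur v
    rw [Subsingleton.elim g 1]
    fin_cases i <;> simp
  obtain ⟨g, hg⟩ := hsurj (Equiv.swap (reps 0) (reps 1)) fun u v => by
    rcases hcases u with rfl | rfl <;> rcases hcases v with rfl | rfl <;> simp [Γ.adj_comm]
  rw [Subsingleton.elim g 1, map_one] at hg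
  exact hne (by simpa using congrArg (fun σ => σ (reps 0)) hg)

theorem exists_sub_mem_iff_mem (T : Finset (ZMod 5)) : ∃ c, ∀ t, c - t ∈ T ↔ t ∈ T := by
  revert T
  decide +kernel

theorem not_hasMGRR_zmod_five_two : ¬ HasMGRR (Multiplicative (ZMod 5)) 2 := by
  classical
  rintro ⟨V, _, Γ, ρ, -, haut, hsurj, -, hsemi, reps, hreps⟩
  let e := Equiv.ofBijective _ (bijective_orbitMap hsemi hreps)
  have hadj : ∀ i j a b, Γ.Adj (e (i, a)) (e (j, b)) ↔ Γ.Adj (reps i) (e (j, b / a)) := by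
    intro i j a b
    rw [← haut a⁻¹]
    simp only [e, Equiv.ofBijective_apply, ← Equiv.Perm.mul_apply, ← map_mul, inv_mul_cancel,
      map_one, Equiv.Perm.one_apply, div_eq_inv_mul]
  have hinv : ∀ i a, Γ.Adj (reps i) (e (i, a⁻¹)) ↔ Γ.Adj (reps i) (e (i, a)) := by
    intro i a
    rw [Γ.adj_comm (reps i) (e (i, a))]
    have := hadj i i a 1
    rw [one_div] at this
    rw [← this]
    simp [e]
  obtain ⟨c, hc⟩ := exists_sub_mem_iff_mem
    (Finset.univ.filter fun t => Γ.Adj (reps 0) (e (1, Multiplicative.ofAdd t)))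
  simp only [Finset.mem_filter, Finset.mem_univ, true_and] at hc
  let s : Fin 2 → Multiplicative (ZMod 5) := ![1, Multiplicative.ofAdd c]
  have hs : Function.Involutive fun x : Fin 2 × Multiplicative (ZMod 5) => (x.1, s x.1 / x.2) :=
    fun x => by simp
  have h01 : ∀ a b, Γ.Adj (e (0, s 0 / a)) (e (1, s 1 / b)) ↔ Γ.Adj (e (0, a)) (e (1, b)) := by
    intro a b
    rw [hadj, hadj 0 1 a b]
    convert hc (b / a).toAdd using 4
    · change c - b.toAdd - (0 - a.toAdd) = c - (b.toAdd - a.toAdd)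
      abel
    · rfl
  obtain ⟨g, hg⟩ := hsurj (e.permCongr hs.toPerm) fun u v => by
    obtain ⟨⟨i, a⟩, rfl⟩ := e.surjective u
    obtain ⟨⟨j, b⟩, rfl⟩ := e.surjective v
    simp only [Equiv.permCongr_apply, Equiv.symm_apply_apply, Function.Involutive.coe_toPerm]
    have hii : ∀ i, Γ.Adj (e (i, s i / a)) (e (i, s i / b)) ↔ Γ.Adj (e (i, a)) (e (i, b)) := by
      intro i
      rw [hadj, hadj i i a b, ← hinv]
      simp
    fin_cases i <;> fin_cases j
    · exact hii 0
    · exact h01 a b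
    · exact (Γ.adj_comm _ _).trans ((h01 b a).trans (Γ.adj_comm _ _))
    · exact hii 1
  have hfix : ∀ a, e.permCongr hs.toPerm (e (0, a)) = e (0, a⁻¹) := fun a => by simp [s]
  have h1 : g = 1 := hsemi g (e (0, 1)) (by rw [hg, hfix, inv_one])
  have h2 := hfix (Multiplicative.ofAdd 1)
  rw [← hg, h1, map_one, Equiv.Perm.one_apply, e.injective.eq_iff, Prod.mk.injEq] at h2
  exact absurd h2.2 (by decide)

/-- for positive `m`, the cyclic group of order 1 has an m-GRR iff `m = 1` or
`m ≥ 10`; of order 2 iff `m = 1` or `m ≥ 5`; of order 3 iff `m ≥ 4`; of order 4 or 5 iff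
`m ≥ 3`. -/
theorem statement_14 :
    (∀ m : ℕ, 1 ≤ m → (HasMGRR (Multiplicative (ZMod 1)) m ↔ (m = 1 ∨ 10 ≤ m))) ∧
    (∀ m : ℕ, 1 ≤ m → (HasMGRR (Multiplicative (ZMod 2)) m ↔ (m = 1 ∨ 5 ≤ m))) ∧
    (∀ m : ℕ, 1 ≤ m → (HasMGRR (Multiplicative (ZMod 3)) m ↔ 4 ≤ m)) ∧
    (∀ m : ℕ, 1 ≤ m → (HasMGRR (Multiplicative (ZMod 4)) m ↔ 3 ≤ m)) ∧
    (∀ m : ℕ, 1 ≤ m → (HasMGRR (Multiplicative (ZMod 5)) m ↔ 3 ≤ m)) := by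
  have hlow : ∀ {k m : ℕ} [NeZero k], 3 ≤ m * k → m * k ≤ 9 →
      ¬ HasMGRR (Multiplicative (ZMod k)) m := fun {k m} _ h3 h9 => by
    have hk : Nat.card (Multiplicative (ZMod k)) = k := Nat.card_zmod k
    have : Finite (Multiplicative (ZMod k)) := inferInstanceAs (Finite (ZMod k))
    exact not_hasMGRR_of_card (by rwa [hk]) (by rwa [hk])
  refine ⟨fun m hm => ⟨fun h => ?_, ?_⟩, fun m hm => ⟨fun h => ?_, ?_⟩,
    fun m hm => ⟨fun h => ?_, hasMGRR_zmod_three⟩, fun m hm => ⟨fun h => ?_, hasMGRR_zmod_four⟩,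
    fun m hm => ⟨fun h => ?_, hasMGRR_zmod_five⟩⟩
  · by_contra hm'
    rcases eq_or_ne m 2 with rfl | h2
    · have : Subsingleton (Multiplicative (ZMod 1)) := inferInstanceAs (Subsingleton (ZMod 1))
      exact not_hasMGRR_two_of_subsingleton h
    · exact hlow (by omega) (by omega) h
  · rintro (rfl | h)
    exacts [hasMGRR_zmod_one_one, hasMGRR_zmod_one h]
  · by_contra hm'
    exact hlow (by omega) (by omega) h
  · rintro (rfl | h)
    exacts [hasMGRR_zmod_two_one, hasMGRR_zmod_two h]
  · by_contra hm'
    exact hlow (by omega) (by omega) h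
  · by_contra hm'
    exact hlow (by omega) (by omega) h
  · by_contra hm'
    rcases eq_or_ne m 2 with rfl | h2
    · exact not_hasMGRR_zmod_five_two h
    · exact hlow (by omega) (by omega) h
end
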